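/- For every integer k ≥ 0 and real δ > -1, and for every index vector with 1 ≤ i_k < ⋯ < i_0, the empirical joint degree frequencies p^{(n)}_{i_0,…,i_k} := N_n(i_0,…,i_k)/(1+(n+1)(k+1)) converge almost surely, as n → ∞, to p_{i_0,…,i_k}, where (p_{i_0,…,i_k})_{1≤i_k<⋯<i_0} is the unique solution of the recursion p_{i_0,…,i_k} = ((i_k-1+δ)/τ) p_{i_0-1,…,i_k-1} + Σ_{m=0}^{k-1} (((i_m-1-k+m)b_m − (i_{m+1}-k+m+1)b_{m+1})/τ) p_{i_0-1,…,i_m-1,i_{m+1},…,i_k} − (((i_0-k)b_0+δ)/τ) p_{i_0,…,i_k} + 1{i_ℓ = k-ℓ+1 for all ℓ=0,…,k}, with terms whose index vectors violate 1 ≤ i_k < ⋯ < i_0 set to 0; moreover (p_{i_0,…,i_k}) is a probability mass function on {1 ≤ i_k < ⋯ < i_0}. -/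

import Mathlib

open MeasureTheory Filter Finset

noncomputable section

/-- The coefficient `b_m = k - m + 1 + δ(k - m)`. -/
def bcoef (k : ℕ) (δ : ℝ) (m : ℕ) : ℝ := (k : ℝ) - m + 1 + δ * ((k : ℝ) - m)

/-- The coefficient `τ = k + 2 + δ(k + 1)`. -/
def tauc (k : ℕ) (δ : ℝ) : ℝ := (k : ℝ) + 2 + δ * ((k : ℝ) + 1)

/-- A vector `(i_0, …, i_k)` of degrees is valid when `1 ≤ i_k < i_{k-1} < ⋯ < i_0`. -/
def ValidIdx (k : ℕ) (i : Fin (k + 1) → ℕ) : Prop :=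
  1 ≤ i (Fin.last k) ∧ StrictAnti i

/-- Decrease every coordinate of the index vector by one. -/
def allDec (k : ℕ) (i : Fin (k + 1) → ℕ) : Fin (k + 1) → ℕ := fun ℓ => i ℓ - 1

/-- Decrease the coordinates `0, …, m` of the index vector by one. -/
def decUpTo (k : ℕ) (m : ℕ) (i : Fin (k + 1) → ℕ) : Fin (k + 1) → ℕ :=
  fun ℓ => if (ℓ : ℕ) ≤ m then i ℓ - 1 else i ℓ

/-- The limiting degree recursion: `p` vanishes outside the valid index vectors, and on the
valid index vectors it satisfies the recursion of Theorem 2.1 of the paper. -/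
def LimitRecursion (k : ℕ) (δ : ℝ) (p : (Fin (k + 1) → ℕ) → ℝ) : Prop :=
  (∀ i, ¬ ValidIdx k i → p i = 0) ∧
  ∀ i, ValidIdx k i →
    p i = ((i (Fin.last k) : ℝ) - 1 + δ) / tauc k δ * p (allDec k i)
      + (∑ m : Fin k,
          (((i m.castSucc : ℝ) - 1 - k + (m : ℕ)) * bcoef k δ (m : ℕ)
            - ((i m.succ : ℝ) - k + (m : ℕ) + 1) * bcoef k δ ((m : ℕ) + 1)) / tauc k δ
            * p (decUpTo k (m : ℕ) i))
      - (((i 0 : ℝ) - k) * bcoef k δ 0 + δ) / tauc k δ * p i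
      + (if ∀ ℓ : Fin (k + 1), i ℓ = k - (ℓ : ℕ) + 1 then (1 : ℝ) else 0)

instance : MeasurableSpace (Finset ℕ) := ⊤
instance : MeasurableSpace (Finset (Finset ℕ)) := ⊤

/-- The `m`-degree of an `m`-simplex `s` in the simplicial complex `g`: the number of
`(m+1)`-simplices (i.e. sets of cardinality `m+2`) of `g` containing `s`. -/
def simDeg (m : ℕ) (g : Finset (Finset ℕ)) (s : Finset ℕ) : ℕ :=
  (g.filter fun t => s ⊆ t ∧ t.card = m + 2).card

/-- The initial complex: one `(k+1)`-simplex on the vertex set `{1, …, k+2}` together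
with all its (nonempty) subsimplices. -/
def initComplex (k : ℕ) : Finset (Finset ℕ) :=
  (Finset.Icc 1 (k + 2)).powerset.filter fun s => s.Nonempty

/-- Add to `g` the simplex `s ∪ {v}` together with all of its (nonempty) subsimplices. -/
def addSimplex (g : Finset (Finset ℕ)) (s : Finset ℕ) (v : ℕ) : Finset (Finset ℕ) :=
  g ∪ (insert v s).powerset.filter fun t => t.Nonempty

/-- The set of `k`-simplices (sets of cardinality `k+1`) of the complex `g`. -/
def kSimplices (k : ℕ) (g : Finset (Finset ℕ)) : Finset (Finset ℕ) :=
  g.filter fun s => s.card = k + 1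

/-- The preferential attachment simplicial complex with parameters `k` and `δ`:
`G n ω` is the complex at time `n`, `choice n ω` is the `k`-simplex selected by the vertex
arriving at time `n ≥ 1`, chosen among the `k`-simplices of `G (n-1)` with conditional
probability proportional to its `k`-degree plus `δ`. -/
structure PAComplex (k : ℕ) (δ : ℝ) (Ω : Type*) [MeasurableSpace Ω] where
  μ : Measure Ω
  isProb : IsProbabilityMeasure μ
  G : ℕ → Ω → Finset (Finset ℕ)
  choice : ℕ → Ω → Finset ℕ
  meas_G : ∀ n, Measurable (G n)
  meas_choice : ∀ n, Measurable (choice n)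
  init : ∀ ω, G 0 ω = initComplex k
  choice_mem : ∀ n ω, 1 ≤ n → choice n ω ∈ kSimplices k (G (n - 1) ω)
  step : ∀ n ω, 1 ≤ n → G n ω = addSimplex (G (n - 1) ω) (choice n ω) (n + k + 2)
  cond_law : ∀ n : ℕ, 1 ≤ n → ∀ g : ℕ → Finset (Finset ℕ),
    ∀ s ∈ kSimplices k (g (n - 1)),
      μ {ω | choice n ω = s ∧ ∀ j < n, G j ω = g j}
        = ENNReal.ofReal (((simDeg k (g (n - 1)) s : ℝ) + δ) /
            ∑ t ∈ kSimplices k (g (n - 1)), ((simDeg k (g (n - 1)) t : ℝ) + δ)) *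
          μ {ω | ∀ j < n, G j ω = g j}

/-- The `c` largest vertices of the simplex `s` (so for an enumeration
`s = {v_0 < v_1 < ⋯ < v_k}` and `c = m+1` this is the youngest `m`-simplex
`{v_{k-m}, …, v_k}`). -/
def topSub (s : Finset ℕ) (c : ℕ) : Finset ℕ :=
  s.filter fun v => (s.filter fun w => v < w).card < c

/-- `Ncount k g i` is the number of `k`-simplices `s = {v_0 < ⋯ < v_k}` of `g` such that
for each `m = 0, …, k` the `m`-degree of the youngest `m`-simplex `{v_{k-m}, …, v_k}`
equals `i m`. -/
def Ncount (k : ℕ) (g : Finset (Finset ℕ)) (i : Fin (k + 1) → ℕ) : ℕ :=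
  ((kSimplices k g).filter fun s =>
    ∀ m : Fin (k + 1), simDeg (m : ℕ) g (topSub s ((m : ℕ) + 1)) = i m).card

/-! ### Simplices of the complex -/

lemma mem_kSimplices {k : ℕ} {g : Finset (Finset ℕ)} {s : Finset ℕ} :
    s ∈ kSimplices k g ↔ s ∈ g ∧ s.card = k + 1 := by
  simp [kSimplices]

/-- The number of simplices of `g` which contain `s` and exactly one further vertex. -/
def coDeg (g : Finset (Finset ℕ)) (s : Finset ℕ) : ℕ :=
  (g.filter fun t => s ⊆ t ∧ t.card = s.card + 1).card

lemma simDeg_eq_coDeg {m : ℕ} {s : Finset ℕ} (g : Finset (Finset ℕ)) (hs : s.card = m + 1) :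
    simDeg m g s = coDeg g s := by
  simp only [simDeg, coDeg, hs]

/-- The total attachment weight of the `k`-simplices of `g` containing `s`. -/
def starWeight (k : ℕ) (δ : ℝ) (g : Finset (Finset ℕ)) (s : Finset ℕ) : ℝ :=
  ∑ t ∈ g with t.card = k + 1 ∧ s ⊆ t, ((coDeg g t : ℝ) + δ)

/-- The complexes which can be reached after `N` attachment steps, starting from the full
`k`-simplex on `{1, …, k+1}`. -/
inductive Reachable (k : ℕ) : ℕ → Finset (Finset ℕ) → Prop
  | zero : Reachable k 0 ((Finset.Icc 1 (k + 1)).powerset.filter fun s => s.Nonempty)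
  | succ {N : ℕ} {g : Finset (Finset ℕ)} {r : Finset ℕ} (hg : Reachable k N g)
      (hr : r ∈ kSimplices k g) : Reachable k (N + 1) (addSimplex g r (N + k + 2))

lemma Reachable.subset_Icc {k N : ℕ} {g : Finset (Finset ℕ)} (h : Reachable k N g) :
    ∀ t ∈ g, t.Nonempty ∧ t ⊆ Icc 1 (N + k + 1) := by
  induction h with
  | zero =>
    intro t ht
    simp only [mem_filter, mem_powerset] at ht
    exact ⟨ht.2, by simpa using ht.1⟩
  | @succ N g r hg hr ih =>
    intro t ht
    simp only [addSimplex, mem_union, mem_filter, mem_powerset] at ht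
    have hmono : Icc 1 (N + k + 1) ⊆ Icc 1 (N + 1 + k + 1) := Icc_subset_Icc le_rfl (by omega)
    rcases ht with ht | ht
    · exact ⟨(ih t ht).1, (ih t ht).2.trans hmono⟩
    · refine ⟨ht.2, ht.1.trans ?_⟩
      refine insert_subset (by simp) ?_
      exact ((ih r (mem_kSimplices.1 hr).1).2).trans hmono

lemma Reachable.down_closed {k N : ℕ} {g : Finset (Finset ℕ)} (h : Reachable k N g) :
    ∀ t ∈ g, ∀ u ⊆ t, u.Nonempty → u ∈ g := by
  induction h with
  | zero =>
    intro t ht u hu hne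
    simp only [mem_filter, mem_powerset] at ht ⊢
    exact ⟨hu.trans ht.1, hne⟩
  | @succ N g r hg hr ih =>
    intro t ht u hu hne
    simp only [addSimplex, mem_union, mem_filter, mem_powerset] at ht ⊢
    rcases ht with ht | ht
    · exact Or.inl (ih t ht u hu hne)
    · exact Or.inr ⟨hu.trans ht.1, hne⟩

lemma Reachable.new_not_mem {k N : ℕ} {g : Finset (Finset ℕ)} (h : Reachable k N g)
    {t : Finset ℕ} (ht : t ∈ g) : N + k + 2 ∉ t := by
  intro hv
  have := mem_Icc.1 ((h.subset_Icc t ht).2 hv)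
  omega

lemma Reachable.sum_addSimplex {M : Type*} [AddCommMonoid M] {k N : ℕ} {g : Finset (Finset ℕ)}
    (h : Reachable k N g) {r : Finset ℕ} (hr : r ∈ kSimplices k g) (F : Finset ℕ → M) :
    ∑ t ∈ addSimplex g r (N + k + 2), F t
      = ∑ t ∈ g, F t + ∑ t ∈ r.powerset, F (insert (N + k + 2) t) := by
  have hrg := (mem_kSimplices.1 hr).1
  have hvr := h.new_not_mem hrg
  have heq : addSimplex g r (N + k + 2) = g ∪ r.powerset.image (insert (N + k + 2)) := by
    ext t
    simp only [addSimplex, mem_union, mem_filter, mem_powerset, mem_image]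
    constructor
    · rintro (ht | ⟨ht, hne⟩)
      · exact Or.inl ht
      · by_cases hv : N + k + 2 ∈ t
        · exact Or.inr ⟨t.erase (N + k + 2), subset_insert_iff.1 ht, insert_erase hv⟩
        · exact Or.inl (h.down_closed r hrg t ((subset_insert_iff_of_notMem hv).1 ht) hne)
    · rintro (ht | ⟨u, hu, rfl⟩)
      · exact Or.inl ht
      · exact Or.inr ⟨insert_subset_insert _ hu, insert_nonempty _ _⟩
  rw [heq, sum_union, sum_image]
  · intro a ha b hb hab
    have ha' : N + k + 2 ∉ a := fun hv => hvr (mem_powerset.1 ha hv)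
    have hb' : N + k + 2 ∉ b := fun hv => hvr (mem_powerset.1 hb hv)
    rw [← erase_insert ha', ← erase_insert hb', hab]
  · rw [disjoint_left]
    rintro t ht ht'
    obtain ⟨u, -, rfl⟩ := mem_image.1 ht'
    exact h.new_not_mem ht (mem_insert_self _ _)

lemma card_powerset_covers {r s : Finset ℕ} :
    (r.powerset.filter fun t => s ⊆ t ∧ t.card = s.card + 1).card
      = if s ⊆ r then r.card - s.card else 0 := by
  split_ifs with hs
  · have : (r.powerset.filter fun t => s ⊆ t ∧ t.card = s.card + 1)
        = (r \ s).image fun x => insert x s := by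
      ext t
      simp only [mem_filter, mem_powerset, mem_image, Finset.mem_sdiff]
      constructor
      · rintro ⟨htr, hst, hc⟩
        have h1 : (t \ s).card = 1 := by rw [card_sdiff_of_subset hst]; omega
        obtain ⟨x, hx⟩ := card_eq_one.1 h1
        have hxt : x ∈ t \ s := by simp [hx]
        rw [Finset.mem_sdiff] at hxt
        refine ⟨x, ⟨htr hxt.1, hxt.2⟩, ?_⟩
        rw [insert_eq, ← hx, sdiff_union_of_subset hst]
      · rintro ⟨x, ⟨hxr, hxs⟩, rfl⟩
        exact ⟨insert_subset hxr hs, subset_insert _ _, card_insert_of_notMem hxs⟩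
    rw [this, card_image_of_injOn, card_sdiff_of_subset hs]
    intro x hx y hy hxy
    simp only [coe_sdiff, Set.mem_sdiff, mem_coe] at hx hy
    have : x ∈ insert y s := by
      have h' : insert x s = insert y s := hxy
      rw [← h']; exact mem_insert_self _ _
    exact (mem_insert.1 this).resolve_right hx.2
  · rw [card_eq_zero, filter_eq_empty_iff]
    rintro t ht ⟨hst, -⟩
    exact hs (hst.trans (mem_powerset.1 ht))

lemma card_powerset_facets {r s : Finset ℕ} {k : ℕ} (hr : r.card = k + 1) :
    (r.powerset.filter fun t => s ⊆ t ∧ t.card = k).card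
      = if s ⊆ r then k + 1 - s.card else 0 := by
  split_ifs with hs
  · have : (r.powerset.filter fun t => s ⊆ t ∧ t.card = k)
        = (r \ s).image fun x => r.erase x := by
      ext t
      simp only [mem_filter, mem_powerset, mem_image, Finset.mem_sdiff]
      constructor
      · rintro ⟨htr, hst, hc⟩
        have h1 : (r \ t).card = 1 := by rw [card_sdiff_of_subset htr]; omega
        obtain ⟨x, hx⟩ := card_eq_one.1 h1
        have hxt : x ∈ r \ t := by simp [hx]
        rw [Finset.mem_sdiff] at hxt
        refine ⟨x, ⟨hxt.1, fun h => hxt.2 (hst h)⟩, ?_⟩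
        rw [erase_eq, ← hx, _root_.sdiff_sdiff_eq_self htr]
      · rintro ⟨x, ⟨hxr, hxs⟩, rfl⟩
        refine ⟨erase_subset _ _, subset_erase.2 ⟨hs, hxs⟩, ?_⟩
        rw [card_erase_of_mem hxr]; omega
    rw [this, card_image_of_injOn, card_sdiff_of_subset hs, hr]
    intro x hx y hy hxy
    simp only [coe_sdiff, Set.mem_sdiff, mem_coe] at hx hy
    by_contra hne
    have h' : r.erase x = r.erase y := hxy
    have : x ∈ r.erase y := mem_erase.2 ⟨hne, hx.1⟩
    rw [← h'] at this
    exact (mem_erase.1 this).1 rfl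
  · rw [card_eq_zero, filter_eq_empty_iff]
    rintro t ht ⟨hst, -⟩
    exact hs (hst.trans (mem_powerset.1 ht))

lemma Reachable.card_filter_addSimplex {k N : ℕ} {g : Finset (Finset ℕ)}
    (h : Reachable k N g) {r : Finset ℕ} (hr : r ∈ kSimplices k g) (P : Finset ℕ → Prop)
    [DecidablePred P] :
    ((addSimplex g r (N + k + 2)).filter P).card
      = (g.filter P).card + (r.powerset.filter fun t => P (insert (N + k + 2) t)).card := by
  simp only [card_filter, h.sum_addSimplex hr]

lemma Reachable.coDeg_old {k N : ℕ} {g : Finset (Finset ℕ)} (h : Reachable k N g)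
    {r : Finset ℕ} (hr : r ∈ kSimplices k g) {s : Finset ℕ} (hs : s = ∅ ∨ s ∈ g) :
    coDeg (addSimplex g r (N + k + 2)) s = coDeg g s + if s ⊆ r then 1 else 0 := by
  have hvr := h.new_not_mem (mem_kSimplices.1 hr).1
  have hvs : N + k + 2 ∉ s := by
    rcases hs with rfl | hs
    · simp
    · exact h.new_not_mem hs
  rw [coDeg, h.card_filter_addSimplex hr, coDeg]
  congr 1
  have : (r.powerset.filter fun t => s ⊆ insert (N + k + 2) t ∧
      (insert (N + k + 2) t).card = s.card + 1) = if s ⊆ r then {s} else ∅ := by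
    ext t
    simp only [mem_filter, mem_powerset, subset_insert_iff_of_notMem hvs]
    constructor
    · rintro ⟨htr, hst, hc⟩
      rw [card_insert_of_notMem fun hv => hvr (htr hv)] at hc
      rw [if_pos (hst.trans htr), mem_singleton]
      exact (eq_of_subset_of_card_le hst (by omega)).symm
    · split_ifs with hsr
      · rw [mem_singleton]
        rintro rfl
        exact ⟨hsr, Subset.rfl, card_insert_of_notMem hvs⟩
      · simp
  rw [this]
  split_ifs <;> simp

lemma Reachable.coDeg_new {k N : ℕ} {g : Finset (Finset ℕ)} (h : Reachable k N g)
    {r : Finset ℕ} (hr : r ∈ kSimplices k g) {s : Finset ℕ} (hs : s ⊆ r) :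
    coDeg (addSimplex g r (N + k + 2)) (insert (N + k + 2) s) = k + 1 - s.card := by
  have hrk := mem_kSimplices.1 hr
  have hvr := h.new_not_mem hrk.1
  have hvs : N + k + 2 ∉ s := fun hv => hvr (hs hv)
  rw [coDeg, h.card_filter_addSimplex hr]
  have h1 : (g.filter fun t => insert (N + k + 2) s ⊆ t ∧
      t.card = (insert (N + k + 2) s).card + 1) = ∅ := by
    rw [filter_eq_empty_iff]
    rintro t ht ⟨hst, -⟩
    exact h.new_not_mem ht (hst (mem_insert_self _ _))
  have h2 : (r.powerset.filter fun t => insert (N + k + 2) s ⊆ insert (N + k + 2) t ∧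
      (insert (N + k + 2) t).card = (insert (N + k + 2) s).card + 1)
      = r.powerset.filter fun t => s ⊆ t ∧ t.card = s.card + 1 := by
    refine filter_congr fun t ht => ?_
    have hvt : N + k + 2 ∉ t := fun hv => hvr (mem_powerset.1 ht hv)
    rw [card_insert_of_notMem hvt, card_insert_of_notMem hvs, insert_subset_insert_iff hvs]
    simp only [add_left_inj]
  rw [h1, h2, card_powerset_covers, if_pos hs, hrk.2]
  simp

/-- The starSlope of the star weight of a simplex with `c` vertices as a function of its degree. -/
def starSlope (k : ℕ) (δ : ℝ) (c : ℕ) : ℝ := (k : ℝ) + 2 - c + δ * ((k : ℝ) + 1 - c)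

lemma Reachable.sum_new_weight {k N : ℕ} {g : Finset (Finset ℕ)} (h : Reachable k N g) {δ : ℝ}
    {r : Finset ℕ} (hr : r ∈ kSimplices k g) (s : Finset ℕ) (hsk : s.card ≤ k + 1) :
    ∑ t ∈ r.powerset with s ⊆ t ∧ t.card = k,
        ((coDeg (addSimplex g r (N + k + 2)) (insert (N + k + 2) t) : ℝ) + δ)
      = if s ⊆ r then ((k : ℝ) + 1 - s.card) * (1 + δ) else 0 := by
  have hrk := mem_kSimplices.1 hr
  have : ∀ t ∈ r.powerset.filter fun t => s ⊆ t ∧ t.card = k,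
      ((coDeg (addSimplex g r (N + k + 2)) (insert (N + k + 2) t) : ℝ) + δ) = 1 + δ := by
    intro t ht
    simp only [mem_filter, mem_powerset] at ht
    rw [h.coDeg_new hr ht.1, ht.2.2]
    simp
  rw [sum_congr rfl this, sum_const, card_powerset_facets hrk.2, nsmul_eq_mul]
  split_ifs
  · rw [Nat.cast_sub hsk]; push_cast; ring
  · simp

lemma Reachable.starWeight_old {k N : ℕ} {g : Finset (Finset ℕ)} (h : Reachable k N g) {δ : ℝ}
    {r : Finset ℕ} (hr : r ∈ kSimplices k g) {s : Finset ℕ} (hs : s = ∅ ∨ s ∈ g)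
    (hsk : s.card ≤ k + 1) :
    starWeight k δ (addSimplex g r (N + k + 2)) s
      = starWeight k δ g s + if s ⊆ r then starSlope k δ s.card else 0 := by
  have hrk := mem_kSimplices.1 hr
  have hvr := h.new_not_mem hrk.1
  have hvs : N + k + 2 ∉ s := by
    rcases hs with rfl | hs
    · simp
    · exact h.new_not_mem hs
  rw [starWeight, sum_filter, h.sum_addSimplex hr, ← sum_filter, ← sum_filter]
  have h2 : (r.powerset.filter fun t => (insert (N + k + 2) t).card = k + 1 ∧
      s ⊆ insert (N + k + 2) t) = r.powerset.filter fun t => s ⊆ t ∧ t.card = k := by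
    refine filter_congr fun t ht => ?_
    have hvt : N + k + 2 ∉ t := fun hv => hvr (mem_powerset.1 ht hv)
    rw [card_insert_of_notMem hvt, subset_insert_iff_of_notMem hvs, and_comm]
    simp
  rw [h2, h.sum_new_weight hr s hsk]
  have h1 : ∀ t ∈ g.filter fun t => t.card = k + 1 ∧ s ⊆ t,
      ((coDeg (addSimplex g r (N + k + 2)) t : ℝ) + δ)
        = ((coDeg g t : ℝ) + δ) + if t = r then 1 else 0 := by
    intro t ht
    simp only [mem_filter] at ht
    rw [h.coDeg_old hr (Or.inr ht.1)]
    have : t ⊆ r ↔ t = r :=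
      ⟨fun hh => eq_of_subset_of_card_le hh (by omega), fun hh => hh ▸ Subset.rfl⟩
    simp only [this]
    split_ifs <;> push_cast <;> ring
  rw [sum_congr rfl h1, sum_add_distrib, sum_ite_eq', starWeight, add_assoc]
  congr 1
  simp only [mem_filter, hrk, true_and, starSlope]
  split_ifs <;> ring

lemma Reachable.starWeight_new {k N : ℕ} {g : Finset (Finset ℕ)} (h : Reachable k N g) {δ : ℝ}
    {r : Finset ℕ} (hr : r ∈ kSimplices k g) {s : Finset ℕ} (hs : s ⊆ r) :
    starWeight k δ (addSimplex g r (N + k + 2)) (insert (N + k + 2) s)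
      = ((k : ℝ) + 1 - s.card) * (1 + δ) := by
  have hrk := mem_kSimplices.1 hr
  have hvr := h.new_not_mem hrk.1
  have hvs : N + k + 2 ∉ s := fun hv => hvr (hs hv)
  rw [starWeight, sum_filter, h.sum_addSimplex hr, ← sum_filter, ← sum_filter]
  have h1 : (g.filter fun t => t.card = k + 1 ∧ insert (N + k + 2) s ⊆ t) = ∅ := by
    rw [filter_eq_empty_iff]
    rintro t ht ⟨-, hst⟩
    exact h.new_not_mem ht (hst (mem_insert_self _ _))
  have h2 : (r.powerset.filter fun t => (insert (N + k + 2) t).card = k + 1 ∧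
      insert (N + k + 2) s ⊆ insert (N + k + 2) t)
      = r.powerset.filter fun t => s ⊆ t ∧ t.card = k := by
    refine filter_congr fun t ht => ?_
    have hvt : N + k + 2 ∉ t := fun hv => hvr (mem_powerset.1 ht hv)
    rw [card_insert_of_notMem hvt, insert_subset_insert_iff hvs, and_comm]
    simp
  rw [h1, h2, h.sum_new_weight hr s (hrk.2 ▸ card_le_card hs), if_pos hs]
  simp

lemma Reachable.mem_or_new {k N : ℕ} {g : Finset (Finset ℕ)} (h : Reachable k N g)
    {r : Finset ℕ} (hr : r ∈ kSimplices k g) {s : Finset ℕ}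
    (hs : s ∈ addSimplex g r (N + k + 2)) :
    s ∈ g ∨ ∃ u ⊆ r, s = insert (N + k + 2) u := by
  simp only [addSimplex, mem_union, mem_filter, mem_powerset] at hs
  rcases hs with hs | ⟨hs, hne⟩
  · exact Or.inl hs
  by_cases hv : N + k + 2 ∈ s
  · exact Or.inr ⟨s.erase (N + k + 2), subset_insert_iff.1 hs, (insert_erase hv).symm⟩
  · exact Or.inl (h.down_closed r (mem_kSimplices.1 hr).1 s
      ((subset_insert_iff_of_notMem hv).1 hs) hne)

lemma kSimplices_simplex (k : ℕ) :
    kSimplices k ((Finset.Icc 1 (k + 1)).powerset.filter fun s => s.Nonempty)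
      = {Icc 1 (k + 1)} := by
  ext t
  simp only [mem_kSimplices, mem_filter, mem_powerset, mem_singleton]
  constructor
  · rintro ⟨⟨h1, -⟩, h2⟩
    exact eq_of_subset_of_card_le h1 (by simp [h2])
  · rintro rfl
    simp

lemma coDeg_simplex {k : ℕ} {s : Finset ℕ} (hs : s ⊆ Icc 1 (k + 1)) :
    coDeg ((Finset.Icc 1 (k + 1)).powerset.filter fun s => s.Nonempty) s = k + 1 - s.card := by
  have := @card_powerset_covers (Icc 1 (k + 1)) s
  rw [if_pos hs, Nat.card_Icc] at this
  rw [coDeg, filter_filter, ← Nat.add_sub_cancel (k + 1) 1, ← this]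
  congr 1
  refine filter_congr fun t ht => ?_
  constructor
  · rintro ⟨-, h2⟩
    exact h2
  · rintro h2
    refine ⟨card_pos.1 ?_, h2⟩
    omega

/-- The attachment weight of the star of a simplex is an affine function of its degree. -/
lemma Reachable.starWeight_eq {k N : ℕ} {g : Finset (Finset ℕ)} (h : Reachable k N g) (δ : ℝ) :
    ∀ s, (s = ∅ ∨ s ∈ g) → s.card ≤ k + 1 →
      starWeight k δ g s = ((coDeg g s : ℝ) - ((k : ℝ) + 1 - s.card)) * starSlope k δ s.card + δ := by
  induction h with
  | zero =>
    intro s hs hsk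
    have hsub : s ⊆ Icc 1 (k + 1) := by
      rcases hs with rfl | hs
      · simp
      · simp only [mem_filter, mem_powerset] at hs
        exact hs.1
    rw [coDeg_simplex hsub, Nat.cast_sub hsk, starWeight, ← filter_filter]
    change ∑ t ∈ (kSimplices k _).filter _, _ = _
    rw [kSimplices_simplex, filter_singleton, if_pos hsub, sum_singleton,
      coDeg_simplex Subset.rfl]
    simp
  | @succ N g r hg hr ih =>
    intro s hs hsk
    have hold : (s = ∅ ∨ s ∈ g) → starWeight k δ (addSimplex g r (N + k + 2)) s
        = ((coDeg (addSimplex g r (N + k + 2)) s : ℝ) - ((k : ℝ) + 1 - s.card))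
          * starSlope k δ s.card + δ := by
      intro hs'
      rw [hg.starWeight_old hr hs' hsk, hg.coDeg_old hr hs', ih s hs' hsk]
      split_ifs <;> push_cast <;> ring
    rcases hs with hs | hs
    · exact hold (Or.inl hs)
    rcases hg.mem_or_new hr hs with hs' | ⟨u, hu, rfl⟩
    · exact hold (Or.inr hs')
    have hvu : N + k + 2 ∉ u := fun hv => hg.new_not_mem (mem_kSimplices.1 hr).1 (hu hv)
    rw [card_insert_of_notMem hvu] at hsk
    rw [hg.starWeight_new hr hu, hg.coDeg_new hr hu, card_insert_of_notMem hvu,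
      Nat.cast_sub (by omega), starSlope]
    push_cast
    ring

lemma Reachable.coDeg_empty {k N : ℕ} {g : Finset (Finset ℕ)} (h : Reachable k N g) :
    coDeg g ∅ = N + k + 1 := by
  induction h with
  | zero => simp [coDeg_simplex]
  | @succ N g r hg hr ih =>
    rw [hg.coDeg_old hr (Or.inl rfl), ih]
    simp
    omega

/-- The total attachment weight after `N` steps. -/
lemma Reachable.sum_weight {k N : ℕ} {g : Finset (Finset ℕ)} (h : Reachable k N g) (δ : ℝ) :
    ∑ t ∈ kSimplices k g, ((simDeg k g t : ℝ) + δ) = N * tauc k δ + δ := by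
  have h1 := h.starWeight_eq δ ∅ (Or.inl rfl) (by simp)
  rw [h.coDeg_empty, starWeight] at h1
  simp only [empty_subset, and_true, card_empty, starSlope] at h1
  rw [kSimplices, sum_congr rfl fun t ht => by
    rw [simDeg_eq_coDeg g (mem_filter.1 ht).2], h1, tauc]
  push_cast
  ring

/-! ### Degree vectors -/

lemma topSub_subset (s : Finset ℕ) (c : ℕ) : topSub s c ⊆ s := filter_subset _ _

lemma topSub_mono (s : Finset ℕ) {c c' : ℕ} (h : c ≤ c') : topSub s c ⊆ topSub s c' := by
  intro v hv
  simp only [topSub, mem_filter] at hv ⊢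
  exact ⟨hv.1, hv.2.trans_le h⟩

lemma card_topSub (s : Finset ℕ) {c : ℕ} (hc : c ≤ s.card) : (topSub s c).card = c := by
  let f : ℕ → ℕ := fun v => (s.filter fun w => v < w).card
  have hlt : ∀ v ∈ s, ∀ w ∈ s, v < w → f w < f v := by
    intro v hv w hw hvw
    refine card_lt_card ?_
    rw [ssubset_iff_of_subset]
    · exact ⟨w, by simp [hw, hvw], by simp⟩
    · intro x hx
      simp only [mem_filter] at hx ⊢
      exact ⟨hx.1, hvw.trans hx.2⟩
  have hinj : Set.InjOn f s := by
    intro v hv w hw h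
    rcases lt_trichotomy v w with h' | h' | h'
    · exact absurd h (hlt v hv w hw h').ne'
    · exact h'
    · exact absurd h (hlt w hw v hv h').ne
  have himg : s.image f = range s.card := by
    refine eq_of_subset_of_card_le ?_ (by rw [card_image_of_injOn hinj, card_range])
    intro x hx
    obtain ⟨v, hv, rfl⟩ := mem_image.1 hx
    rw [mem_range]
    refine card_lt_card ?_
    rw [ssubset_iff_of_subset (filter_subset _ _)]
    exact ⟨v, hv, by simp⟩
  have h2 : (topSub s c).image f = range c := by
    ext x
    simp only [mem_image, topSub, mem_filter, mem_range]
    constructor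
    · rintro ⟨v, ⟨-, hv⟩, rfl⟩
      exact hv
    · intro hx
      have : x ∈ s.image f := by rw [himg, mem_range]; omega
      obtain ⟨v, hv, rfl⟩ := mem_image.1 this
      exact ⟨v, ⟨hv, hx⟩, rfl⟩
  rw [← card_image_of_injOn (hinj.mono (topSub_subset s c)), h2, card_range]

lemma topSub_card_self (s : Finset ℕ) : topSub s s.card = s :=
  eq_of_subset_of_card_le (topSub_subset _ _) (card_topSub s le_rfl).ge

/-- The vector of degrees of the youngest subsimplices of a `k`-simplex. -/
def degVec (k : ℕ) (g : Finset (Finset ℕ)) (s : Finset ℕ) : Fin (k + 1) → ℕ :=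
  fun m => simDeg (m : ℕ) g (topSub s ((m : ℕ) + 1))

lemma degVec_apply {k : ℕ} (g : Finset (Finset ℕ)) {s : Finset ℕ} (hs : s.card = k + 1)
    (m : Fin (k + 1)) : degVec k g s m = coDeg g (topSub s ((m : ℕ) + 1)) :=
  simDeg_eq_coDeg g (card_topSub s (by omega))

lemma Ncount_eq (k : ℕ) (g : Finset (Finset ℕ)) (i : Fin (k + 1) → ℕ) :
    Ncount k g i = ((kSimplices k g).filter fun s => degVec k g s = i).card := by
  simp only [Ncount, degVec, funext_iff]

lemma Reachable.topSub_mem {k N : ℕ} {g : Finset (Finset ℕ)} (h : Reachable k N g)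
    {s : Finset ℕ} (hs : s ∈ kSimplices k g) {c : ℕ} (hc : c ≤ k) : topSub s (c + 1) ∈ g := by
  rw [mem_kSimplices] at hs
  refine h.down_closed s hs.1 _ (topSub_subset _ _) ?_
  rw [← card_pos, card_topSub s (by omega)]
  omega

lemma Reachable.degVec_old {k N : ℕ} {g : Finset (Finset ℕ)} (h : Reachable k N g)
    {r : Finset ℕ} (hr : r ∈ kSimplices k g) {s : Finset ℕ} (hs : s ∈ kSimplices k g)
    (m : Fin (k + 1)) :
    degVec k (addSimplex g r (N + k + 2)) s m
      = degVec k g s m + if topSub s ((m : ℕ) + 1) ⊆ r then 1 else 0 := by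
  have hsk := (mem_kSimplices.1 hs).2
  rw [degVec_apply _ hsk, degVec_apply _ hsk,
    h.coDeg_old hr (Or.inr (h.topSub_mem hs (by omega)))]

lemma Reachable.new_mem_topSub {k N : ℕ} {g : Finset (Finset ℕ)} (h : Reachable k N g)
    {r : Finset ℕ} (hr : r ∈ kSimplices k g) {u : Finset ℕ} (hu : u ⊆ r) (c : ℕ) :
    N + k + 2 ∈ topSub (insert (N + k + 2) u) (c + 1) := by
  simp only [topSub, mem_filter, mem_insert, true_or, true_and]
  rw [filter_eq_empty_iff.2, card_empty]
  · omega
  · intro w hw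
    rcases mem_insert.1 hw with rfl | hw
    · exact lt_irrefl _
    · have := mem_Icc.1 ((h.subset_Icc r (mem_kSimplices.1 hr).1).2 (hu hw))
      omega

lemma Reachable.degVec_new {k N : ℕ} {g : Finset (Finset ℕ)} (h : Reachable k N g)
    {r : Finset ℕ} (hr : r ∈ kSimplices k g) {u : Finset ℕ} (hu : u ∈ r.powersetCard k)
    (m : Fin (k + 1)) :
    degVec k (addSimplex g r (N + k + 2)) (insert (N + k + 2) u) m = k - (m : ℕ) + 1 := by
  obtain ⟨hur, huk⟩ := mem_powersetCard.1 hu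
  have hvr := h.new_not_mem (mem_kSimplices.1 hr).1
  have hcard : (insert (N + k + 2) u).card = k + 1 := by
    rw [card_insert_of_notMem fun hv => hvr (hur hv), huk]
  rw [degVec_apply _ hcard]
  have hv := h.new_mem_topSub hr hur m
  have hc := card_topSub (insert (N + k + 2) u) (c := (m : ℕ) + 1) (by omega)
  have hsub : (topSub (insert (N + k + 2) u) ((m : ℕ) + 1)).erase (N + k + 2) ⊆ r :=
    (subset_insert_iff.1 (topSub_subset _ _)).trans hur
  have := h.coDeg_new hr hsub
  rw [insert_erase hv, card_erase_of_mem hv, hc] at this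
  rw [this]
  omega

lemma Reachable.sum_kSimplices {M : Type*} [AddCommMonoid M] {k N : ℕ}
    {g : Finset (Finset ℕ)} (h : Reachable k N g) {r : Finset ℕ} (hr : r ∈ kSimplices k g)
    (F : Finset ℕ → M) :
    ∑ s ∈ kSimplices k (addSimplex g r (N + k + 2)), F s
      = ∑ s ∈ kSimplices k g, F s + ∑ u ∈ r.powersetCard k, F (insert (N + k + 2) u) := by
  have hvr := h.new_not_mem (mem_kSimplices.1 hr).1
  rw [kSimplices, sum_filter, h.sum_addSimplex hr, ← sum_filter, ← sum_filter, kSimplices]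
  congr 2
  ext u
  simp only [mem_filter, mem_powerset, mem_powersetCard]
  refine and_congr_right fun hu => ?_
  rw [card_insert_of_notMem fun hv => hvr (hu hv), add_left_inj]

/-- The degree vector of a newly created `k`-simplex. -/
def birthIdx (k : ℕ) : Fin (k + 1) → ℕ := fun ℓ => k - (ℓ : ℕ) + 1

lemma Reachable.Ncount_succ {k N : ℕ} {g : Finset (Finset ℕ)} (h : Reachable k N g)
    {r : Finset ℕ} (hr : r ∈ kSimplices k g) (i : Fin (k + 1) → ℕ) :
    Ncount k (addSimplex g r (N + k + 2)) i
      = ((kSimplices k g).filter fun s => degVec k (addSimplex g r (N + k + 2)) s = i).card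
        + if i = birthIdx k then k + 1 else 0 := by
  rw [Ncount_eq, card_filter, h.sum_kSimplices hr, ← card_filter]
  congr 1
  have : ∀ u ∈ r.powersetCard k,
      (if degVec k (addSimplex g r (N + k + 2)) (insert (N + k + 2) u) = i then 1 else 0)
        = if i = birthIdx k then 1 else 0 := by
    intro u hu
    have : degVec k (addSimplex g r (N + k + 2)) (insert (N + k + 2) u) = birthIdx k :=
      funext fun m => h.degVec_new hr hu m
    rw [this]
    simp only [eq_comm]
  rw [sum_congr rfl this, sum_const, card_powersetCard, (mem_kSimplices.1 hr).2]
  simp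

lemma validIdx_birthIdx (k : ℕ) : ValidIdx k (birthIdx k) := by
  refine ⟨by simp [birthIdx], fun a b hab => ?_⟩
  have h1 : (a : ℕ) < b := hab
  simp only [birthIdx]
  omega

lemma Reachable.strictAnti_degVec {k N : ℕ} {g : Finset (Finset ℕ)} (h : Reachable k N g) :
    ∀ s ∈ kSimplices k g, StrictAnti (degVec k g s) := by
  induction h with
  | zero =>
    intro s hs a b hab
    have hsk := (mem_kSimplices.1 hs).2
    rw [kSimplices_simplex, mem_singleton] at hs
    have h1 : (a : ℕ) < b := hab
    have hsub : ∀ c, topSub s c ⊆ Icc 1 (k + 1) := fun c => hs ▸ topSub_subset s c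
    rw [degVec_apply _ hsk, degVec_apply _ hsk, coDeg_simplex (hsub _), coDeg_simplex (hsub _),
      card_topSub s (by omega), card_topSub s (by omega)]
    omega
  | @succ N g r hg hr ih =>
    intro s hs
    rw [mem_kSimplices] at hs
    rcases hg.mem_or_new hr hs.1 with hs' | ⟨u, hu, rfl⟩
    · have hsg := mem_kSimplices.2 ⟨hs', hs.2⟩
      intro a b hab
      have h1 : (a : ℕ) < b := hab
      have := ih s hsg hab
      rw [hg.degVec_old hr hsg, hg.degVec_old hr hsg]
      have hm := topSub_mono s (show (a : ℕ) + 1 ≤ (b : ℕ) + 1 by omega)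
      split_ifs with h2 h3
      · omega
      · exact absurd (hm.trans h2) h3
      · omega
      · omega
    · have hvu : N + k + 2 ∉ u := fun hv => hg.new_not_mem (mem_kSimplices.1 hr).1 (hu hv)
      have huk : u ∈ r.powersetCard k :=
        mem_powersetCard.2 ⟨hu, by have := hs.2; rw [card_insert_of_notMem hvu] at this; omega⟩
      have : degVec k (addSimplex g r (N + k + 2)) (insert (N + k + 2) u) = birthIdx k :=
        funext fun m => hg.degVec_new hr huk m
      rw [this]
      exact (validIdx_birthIdx k).2

lemma Reachable.one_le_degVec_last {k N : ℕ} {g : Finset (Finset ℕ)} (h : Reachable k N g)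
    (hN : N ≠ 0) : ∀ s ∈ kSimplices k g, 1 ≤ degVec k g s (Fin.last k) := by
  induction h with
  | zero => exact absurd rfl hN
  | @succ N g r hg hr ih =>
    intro s hs
    rw [mem_kSimplices] at hs
    rcases hg.mem_or_new hr hs.1 with hs' | ⟨u, hu, rfl⟩
    · have hsg := mem_kSimplices.2 ⟨hs', hs.2⟩
      rw [hg.degVec_old hr hsg]
      rcases Nat.eq_zero_or_pos N with rfl | hN
      · cases hg
        rw [kSimplices_simplex, mem_singleton] at hr hsg
        rw [if_pos]
        · omega
        · rw [hr, ← hsg]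
          exact topSub_subset _ _
      · have := ih hN.ne' s hsg
        omega
    · have hvu : N + k + 2 ∉ u := fun hv => hg.new_not_mem (mem_kSimplices.1 hr).1 (hu hv)
      have huk : u ∈ r.powersetCard k :=
        mem_powersetCard.2 ⟨hu, by have := hs.2; rw [card_insert_of_notMem hvu] at this; omega⟩
      rw [hg.degVec_new hr huk]
      omega

lemma Reachable.validIdx_degVec {k N : ℕ} {g : Finset (Finset ℕ)} (h : Reachable k N g)
    (hN : N ≠ 0) {s : Finset ℕ} (hs : s ∈ kSimplices k g) : ValidIdx k (degVec k g s) :=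
  ⟨h.one_le_degVec_last hN s hs, h.strictAnti_degVec s hs⟩

lemma Reachable.one_le_simDeg {k N : ℕ} {g : Finset (Finset ℕ)} (h : Reachable k N g)
    (hN : N ≠ 0) {s : Finset ℕ} (hs : s ∈ kSimplices k g) : 1 ≤ simDeg k g s := by
  have h1 := h.one_le_degVec_last hN s hs
  have h2 : topSub s (k + 1) = s := by
    rw [← (mem_kSimplices.1 hs).2, topSub_card_self]
  simpa [degVec, h2] using h1

lemma Reachable.Ncount_eq_zero {k N : ℕ} {g : Finset (Finset ℕ)} (h : Reachable k N g)
    (hN : N ≠ 0) {i : Fin (k + 1) → ℕ} (hi : ¬ ValidIdx k i) : Ncount k g i = 0 := by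
  rw [Ncount_eq, card_eq_zero, filter_eq_empty_iff]
  rintro s hs rfl
  exact hi (h.validIdx_degVec hN hs)

lemma ValidIdx.one_le {k : ℕ} {i : Fin (k + 1) → ℕ} (hi : ValidIdx k i) (ℓ : Fin (k + 1)) :
    1 ≤ i ℓ :=
  hi.1.trans (hi.2.antitone (Fin.le_last ℓ))

/-! ### The one-step change of the degree counts -/

lemma Reachable.card_topSub_eq_le {k N : ℕ} {g : Finset (Finset ℕ)} (h : Reachable k N g) :
    ∀ x, ((kSimplices k g).filter fun s => topSub s 1 = {x}).card ≤ k + 1 := by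
  induction h with
  | zero =>
    intro x
    rw [kSimplices_simplex]
    exact (card_filter_le _ _).trans (by simp)
  | @succ N g r hg hr ih =>
    intro x
    rw [card_filter, hg.sum_kSimplices hr, ← card_filter, ← card_filter]
    by_cases hx : x = N + k + 2
    · subst hx
      have h1 : ((kSimplices k g).filter fun s => topSub s 1 = {N + k + 2}) = ∅ := by
        rw [filter_eq_empty_iff]
        intro s hs hs1
        refine hg.new_not_mem (mem_kSimplices.1 hs).1 (topSub_subset s 1 ?_)
        rw [hs1]
        exact mem_singleton_self _
      rw [h1, card_empty, zero_add]
      refine (card_filter_le _ _).trans ?_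
      rw [card_powersetCard, (mem_kSimplices.1 hr).2]
      simp
    · have h1 : ((r.powersetCard k).filter fun u =>
          topSub (insert (N + k + 2) u) 1 = {x}) = ∅ := by
        rw [filter_eq_empty_iff]
        intro u hu hu1
        have := hg.new_mem_topSub hr (mem_powersetCard.1 hu).1 0
        rw [zero_add, hu1, mem_singleton] at this
        exact hx this.symm
      rw [h1, card_empty, add_zero]
      exact ih x

lemma Reachable.card_affected_le {k N : ℕ} {g : Finset (Finset ℕ)} (h : Reachable k N g)
    {r : Finset ℕ} (hr : r.card = k + 1) :
    ((kSimplices k g).filter fun s => topSub s 1 ⊆ r).card ≤ (k + 1) * (k + 1) := by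
  have hsub : ((kSimplices k g).filter fun s => topSub s 1 ⊆ r)
      ⊆ r.biUnion fun x => (kSimplices k g).filter fun s => topSub s 1 = {x} := by
    intro s hs
    rw [mem_filter] at hs
    obtain ⟨x, hx⟩ := card_eq_one.1 (card_topSub s (c := 1)
      (by rw [(mem_kSimplices.1 hs.1).2]; omega))
    have hxr := hs.2
    rw [hx, singleton_subset_iff] at hxr
    exact mem_biUnion.2 ⟨x, hxr, mem_filter.2 ⟨hs.1, hx⟩⟩
  refine (card_le_card hsub).trans (card_biUnion_le.trans ?_)
  calc ∑ x ∈ r, ((kSimplices k g).filter fun s => topSub s 1 = {x}).card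
      ≤ ∑ _x ∈ r, (k + 1) := sum_le_sum fun x _ => h.card_topSub_eq_le x
    _ = (k + 1) * (k + 1) := by rw [sum_const, hr, smul_eq_mul]

lemma Reachable.abs_Ncount_sub_le {k N : ℕ} {g : Finset (Finset ℕ)} (h : Reachable k N g)
    {r : Finset ℕ} (hr : r ∈ kSimplices k g) (i : Fin (k + 1) → ℕ) :
    |(Ncount k (addSimplex g r (N + k + 2)) i : ℝ) - Ncount k g i| ≤ (k + 1) * (k + 2) := by
  set A := (kSimplices k g).filter fun s => topSub s 1 ⊆ r
  have hA : A.card ≤ (k + 1) * (k + 1) := h.card_affected_le (mem_kSimplices.1 hr).2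
  have key : ∀ s ∈ kSimplices k g, s ∉ A →
      degVec k (addSimplex g r (N + k + 2)) s = degVec k g s := by
    intro s hs hsA
    have h1 : ¬ topSub s 1 ⊆ r := fun hh => hsA (mem_filter.2 ⟨hs, hh⟩)
    funext m
    rw [h.degVec_old hr hs, if_neg, add_zero]
    exact fun hh => h1 ((topSub_mono s (by omega)).trans hh)
  set B := (kSimplices k g).filter fun s => degVec k (addSimplex g r (N + k + 2)) s = i
    with hB
  set C := (kSimplices k g).filter fun s => degVec k g s = i with hC
  have hBC : B.card ≤ C.card + A.card := by
    refine (card_le_card ?_).trans (card_union_le C A)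
    intro s hs
    rw [hB, mem_filter] at hs
    by_cases hsA : s ∈ A
    · exact mem_union_right _ hsA
    · exact mem_union_left _ (mem_filter.2 ⟨hs.1, key s hs.1 hsA ▸ hs.2⟩)
  have hCB : C.card ≤ B.card + A.card := by
    refine (card_le_card ?_).trans (card_union_le B A)
    intro s hs
    rw [hC, mem_filter] at hs
    by_cases hsA : s ∈ A
    · exact mem_union_right _ hsA
    · exact mem_union_left _ (mem_filter.2 ⟨hs.1, (key s hs.1 hsA).trans hs.2⟩)
  rw [h.Ncount_succ hr, Ncount_eq k g, ← hB, ← hC]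
  have e : (if i = birthIdx k then k + 1 else 0) ≤ k + 1 := by split_ifs <;> omega
  have e' : (k + 1) * (k + 2) = (k + 1) * (k + 1) + (k + 1) := by ring
  generalize (if i = birthIdx k then k + 1 else 0) = z at e ⊢
  rw [abs_le]
  have h1 : C.card ≤ B.card + z + (k + 1) * (k + 2) := by omega
  have h2 : B.card + z ≤ C.card + (k + 1) * (k + 2) := by omega
  have h1' : (C.card : ℝ) ≤ B.card + z + (k + 1) * (k + 2) := by exact_mod_cast h1
  have h2' : (B.card + z : ℝ) ≤ C.card + (k + 1) * (k + 2) := by exact_mod_cast h2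
  push_cast
  constructor <;> linarith

/-- The attachment weight of the star of the youngest `m`-simplex of a `k`-simplex with degree
vector `i`; it is zero for `m > k`. -/
def starRate (k : ℕ) (δ : ℝ) (i : Fin (k + 1) → ℕ) (m : ℕ) : ℝ :=
  if h : m < k + 1 then ((i ⟨m, h⟩ : ℝ) - k + m) * bcoef k δ m + δ else 0

/-- The total weighted flow into the index `i`, for counts `f`. -/
def inflow (k : ℕ) (δ : ℝ) (f : (Fin (k + 1) → ℕ) → ℝ) (i : Fin (k + 1) → ℕ) : ℝ :=
  ∑ j ∈ range (k + 1), (starRate k δ (decUpTo k j i) j - starRate k δ (decUpTo k j i) (j + 1))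
    * f (decUpTo k j i)

lemma Reachable.sum_weight_topSub {k N : ℕ} {g : Finset (Finset ℕ)} (h : Reachable k N g)
    (δ : ℝ) {s : Finset ℕ} (hs : s ∈ kSimplices k g) (m : ℕ) :
    ∑ r ∈ kSimplices k g, ((simDeg k g r : ℝ) + δ)
        * (if m < k + 1 ∧ topSub s (m + 1) ⊆ r then 1 else 0)
      = starRate k δ (degVec k g s) m := by
  rw [starRate]
  split_ifs with hm
  · have hsk := (mem_kSimplices.1 hs).2
    have hc : (topSub s (m + 1)).card = m + 1 := card_topSub s (by omega)
    have h1 := h.starWeight_eq δ _ (Or.inr (h.topSub_mem hs (c := m) (by omega))) (by omega)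
    rw [hc, starWeight] at h1
    rw [degVec_apply g hsk]
    simp only [hm, true_and, mul_ite, mul_one, mul_zero]
    rw [← sum_filter, kSimplices, filter_filter]
    rw [sum_congr rfl fun t ht => by
      rw [simDeg_eq_coDeg g (mem_filter.1 ht).2.1], h1, starSlope, bcoef]
    push_cast
    ring
  · simp [hm]

lemma indicator_add_eq {k : ℕ} (d i : Fin (k + 1) → ℕ) (hi : ∀ ℓ, 1 ≤ i ℓ) (x : ℕ → Prop)
    [DecidablePred x] (hx : ∀ ℓ, x (ℓ + 1) → x ℓ) (hxk : ¬ x (k + 1)) :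
    (if (fun ℓ : Fin (k + 1) => d ℓ + if x ℓ then 1 else 0) = i then (1 : ℝ) else 0)
      = (1 - if x 0 then 1 else 0) * (if d = i then 1 else 0)
        + ∑ j ∈ range (k + 1), ((if x j then 1 else 0) - if x (j + 1) then 1 else 0)
          * (if d = decUpTo k j i then 1 else 0) := by
  have hanti : ∀ a b, a ≤ b → x b → x a := by
    intro a b hab
    induction hab with
    | refl => exact id
    | step _ ih => exact fun h => ih (hx _ h)
  have hex : ∃ ℓ, ¬ x ℓ := ⟨k + 1, hxk⟩
  obtain ⟨J, hJ, hJmin⟩ : ∃ J, ¬ x J ∧ ∀ m < J, x m :=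
    ⟨Nat.find hex, Nat.find_spec hex, fun m hm => not_not.1 (Nat.find_min hex hm)⟩
  have hiff : ∀ ℓ, x ℓ ↔ ℓ < J :=
    fun ℓ => ⟨fun h => not_le.1 fun h' => hJ (hanti _ _ h' h), hJmin ℓ⟩
  have hJk : J ≤ k + 1 := not_lt.1 fun h => hxk (hJmin _ h)
  simp only [hiff]
  rcases Nat.eq_zero_or_pos J with rfl | hJ0
  · simp
  obtain ⟨J', rfl⟩ : ∃ J', J = J' + 1 := ⟨J - 1, by omega⟩
  rw [sum_eq_single J']
  · have : ((fun ℓ : Fin (k + 1) => d ℓ + if (ℓ : ℕ) < J' + 1 then 1 else 0) = i)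
        ↔ d = decUpTo k J' i := by
      simp only [funext_iff, decUpTo]
      refine forall_congr' fun ℓ => ?_
      have := hi ℓ
      split_ifs <;> omega
    rw [if_congr this rfl rfl]
    simp
  · intro j _ hj
    have : (j < J' + 1) ↔ (j + 1 < J' + 1) := by omega
    rw [if_congr this rfl rfl, sub_self, zero_mul]
  · intro hj
    exact absurd (mem_range.2 (by omega)) hj

/-- The weighted sum, over all possible choices, of the next degree counts. -/
lemma Reachable.sum_weight_Ncount {k N : ℕ} {g : Finset (Finset ℕ)} (h : Reachable k N g)
    (δ : ℝ) {i : Fin (k + 1) → ℕ} (hi : ∀ ℓ, 1 ≤ i ℓ) :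
    ∑ r ∈ kSimplices k g, ((simDeg k g r : ℝ) + δ)
        * (Ncount k (addSimplex g r (N + k + 2)) i : ℝ)
      = (N * tauc k δ + δ) * (Ncount k g i + if i = birthIdx k then (k : ℝ) + 1 else 0)
        + (inflow k δ (fun j => (Ncount k g j : ℝ)) i - starRate k δ i 0 * Ncount k g i) := by
  have hcount : ∀ j, (Ncount k g j : ℝ)
      = ∑ s ∈ kSimplices k g, if degVec k g s = j then (1 : ℝ) else 0 := by
    intro j
    rw [Ncount_eq, card_filter]
    push_cast
    rfl
  have hstep : ∀ r ∈ kSimplices k g, (Ncount k (addSimplex g r (N + k + 2)) i : ℝ)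
      = ∑ s ∈ kSimplices k g,
          ((1 - if 0 < k + 1 ∧ topSub s (0 + 1) ⊆ r then 1 else 0)
              * (if degVec k g s = i then 1 else 0)
            + ∑ j ∈ range (k + 1), ((if j < k + 1 ∧ topSub s (j + 1) ⊆ r then 1 else 0)
                - if j + 1 < k + 1 ∧ topSub s (j + 1 + 1) ⊆ r then 1 else 0)
              * (if degVec k g s = decUpTo k j i then 1 else 0))
        + if i = birthIdx k then (k : ℝ) + 1 else 0 := by
    intro r hr
    rw [h.Ncount_succ hr, card_filter]
    push_cast
    congr 1
    refine sum_congr rfl fun s hs => ?_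
    rw [← indicator_add_eq (degVec k g s) i hi (fun m => m < k + 1 ∧ topSub s (m + 1) ⊆ r)
      (fun ℓ hℓ => ⟨by omega, (topSub_mono s (by omega)).trans hℓ.2⟩) (by omega)]
    congr 2
    funext ℓ
    rw [h.degVec_old hr hs]
    simp only [ℓ.2, true_and]
  have hinner : ∀ s ∈ kSimplices k g,
      ∑ r ∈ kSimplices k g, ((simDeg k g r : ℝ) + δ)
        * ((1 - if 0 < k + 1 ∧ topSub s (0 + 1) ⊆ r then 1 else 0)
              * (if degVec k g s = i then 1 else 0)
            + ∑ j ∈ range (k + 1), ((if j < k + 1 ∧ topSub s (j + 1) ⊆ r then 1 else 0)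
                - if j + 1 < k + 1 ∧ topSub s (j + 1 + 1) ⊆ r then 1 else 0)
              * (if degVec k g s = decUpTo k j i then 1 else 0))
      = ((N * tauc k δ + δ) - starRate k δ i 0) * (if degVec k g s = i then 1 else 0)
        + ∑ j ∈ range (k + 1), (starRate k δ (decUpTo k j i) j
            - starRate k δ (decUpTo k j i) (j + 1))
          * (if degVec k g s = decUpTo k j i then 1 else 0) := by
    intro s hs
    have hd : ∀ (e : Fin (k + 1) → ℕ) (m : ℕ),
        starRate k δ e m * (if degVec k g s = e then 1 else 0)
          = (∑ r ∈ kSimplices k g, ((simDeg k g r : ℝ) + δ)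
            * (if m < k + 1 ∧ topSub s (m + 1) ⊆ r then 1 else 0))
            * (if degVec k g s = e then 1 else 0) := by
      intro e m
      rw [h.sum_weight_topSub δ hs m]
      split_ifs with he
      · rw [he]
      · simp
    simp only [sub_mul, hd]
    rw [← h.sum_weight δ]
    simp only [sum_mul, mul_add, mul_sub, sum_add_distrib, sum_sub_distrib, mul_sum,
      one_mul, mul_assoc]
    refine congr_arg₂ (· + ·) ?_ (congr_arg₂ (· - ·) sum_comm sum_comm)
    rw [← sum_add_distrib, sum_mul]
  rw [sum_congr rfl fun r hr => by rw [hstep r hr, mul_add, mul_sum], sum_add_distrib, sum_comm,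
    sum_congr rfl hinner, ← sum_mul, h.sum_weight δ, sum_add_distrib, ← mul_sum, ← hcount,
    sum_comm]
  simp only [← mul_sum, ← hcount, inflow]
  ring

/-! ### The limiting recursion -/

lemma ValidIdx.sub_le {k : ℕ} {i : Fin (k + 1) → ℕ} (hi : ValidIdx k i) (ℓ : Fin (k + 1)) :
    k + 1 ≤ i ℓ + ℓ := by
  have key : ∀ n, n ≤ k → ∀ ℓ : Fin (k + 1), (ℓ : ℕ) = k - n → n + 1 ≤ i ℓ := by
    intro n
    induction n with
    | zero => exact fun _ ℓ _ => hi.one_le ℓ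
    | succ n ih =>
      intro hn ℓ hℓ
      have h1 := ih (by omega) ⟨k - n, by omega⟩ rfl
      have h2 : i ⟨k - n, by omega⟩ < i ℓ := hi.2 (by rw [Fin.lt_def]; simp only; omega)
      omega
  have := key (k - ℓ) (by omega) ℓ (by omega)
  omega

lemma bcoef_eq (k : ℕ) (δ : ℝ) (m : ℕ) : bcoef k δ m = ((k : ℝ) - m) * (1 + δ) + 1 := by
  rw [bcoef]; ring

lemma one_le_bcoef {k m : ℕ} {δ : ℝ} (hδ : -1 < δ) (hm : m ≤ k) : 1 ≤ bcoef k δ m := by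
  rw [bcoef_eq]
  have h1 : (m : ℝ) ≤ k := by exact_mod_cast hm
  nlinarith

lemma tauc_pos (k : ℕ) {δ : ℝ} (hδ : -1 < δ) : 0 < tauc k δ := by
  rw [tauc]
  have : (0 : ℝ) ≤ k := Nat.cast_nonneg k
  nlinarith

lemma ValidIdx.starRate_pos {k : ℕ} {δ : ℝ} (hδ : -1 < δ) {i : Fin (k + 1) → ℕ}
    (hi : ValidIdx k i) {m : ℕ} (hm : m < k + 1) : 0 < starRate k δ i m := by
  rw [starRate, dif_pos hm]
  have h1 : ((k : ℝ) + 1) ≤ i ⟨m, hm⟩ + m := by exact_mod_cast hi.sub_le ⟨m, hm⟩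
  have h2 := one_le_bcoef hδ (show m ≤ k by omega)
  nlinarith

lemma ValidIdx.starRate_succ_le {k : ℕ} {δ : ℝ} (hδ : -1 < δ) {i : Fin (k + 1) → ℕ}
    (hi : ValidIdx k i) {m : ℕ} (hm : m < k + 1) :
    0 ≤ starRate k δ i m - starRate k δ i (m + 1) := by
  by_cases hm' : m + 1 < k + 1
  · rw [starRate, dif_pos hm, starRate, dif_pos hm']
    have h1 : ((k : ℝ) + 1) ≤ i ⟨m + 1, hm'⟩ + (m + 1) := by
      exact_mod_cast hi.sub_le ⟨m + 1, hm'⟩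
    have h2 : ((i ⟨m + 1, hm'⟩ : ℝ)) + 1 ≤ i ⟨m, hm⟩ := by
      exact_mod_cast (hi.2 (show (⟨m, hm⟩ : Fin (k + 1)) < ⟨m + 1, hm'⟩ by
        rw [Fin.lt_def]; simp))
    have h3 := one_le_bcoef hδ (show m + 1 ≤ k by omega)
    have h4 : bcoef k δ m = bcoef k δ (m + 1) + (1 + δ) := by
      rw [bcoef_eq, bcoef_eq]; push_cast; ring
    rw [h4]
    push_cast
    nlinarith [mul_nonneg (sub_nonneg.2 h2) (show 0 ≤ bcoef k δ (m + 1) by linarith),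
      mul_nonneg (show (0 : ℝ) ≤ i ⟨m, hm⟩ - k + m by linarith) (show 0 ≤ 1 + δ by linarith)]
  · have h0 : starRate k δ i (m + 1) = 0 := by rw [starRate, dif_neg hm']
    rw [h0, sub_zero]
    exact (hi.starRate_pos hδ hm).le

lemma sum_starRate_sub {k : ℕ} (δ : ℝ) (i : Fin (k + 1) → ℕ) :
    ∑ j ∈ range (k + 1), (starRate k δ i j - starRate k δ i (j + 1)) = starRate k δ i 0 := by
  rw [sum_range_sub']
  simp [starRate]

lemma limitRecursion_iff {k : ℕ} {δ : ℝ} {p : (Fin (k + 1) → ℕ) → ℝ} :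
    LimitRecursion k δ p ↔ (∀ i, ¬ ValidIdx k i → p i = 0) ∧
      ∀ i, ValidIdx k i → p i = inflow k δ p i / tauc k δ
        - starRate k δ i 0 / tauc k δ * p i + if i = birthIdx k then 1 else 0 := by
  refine and_congr_right fun _ => forall_congr' fun i => forall_congr' fun hi => ?_
  have e1 : (((i (Fin.last k) : ℝ) - 1 + δ) / tauc k δ * p (allDec k i)
      + (∑ m : Fin k,
          (((i m.castSucc : ℝ) - 1 - k + (m : ℕ)) * bcoef k δ (m : ℕ)
            - ((i m.succ : ℝ) - k + (m : ℕ) + 1) * bcoef k δ ((m : ℕ) + 1)) / tauc k δ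
            * p (decUpTo k (m : ℕ) i))) = inflow k δ p i / tauc k δ := by
    conv_lhs => rw [add_comm]
    conv_rhs => rw [inflow, sum_range_succ, add_div, sum_div, sum_range]
    congr 1
    · refine sum_congr rfl fun m _ => ?_
      have hm : (m : ℕ) < k + 1 := by omega
      have hm' : (m : ℕ) + 1 < k + 1 := by omega
      rw [starRate, dif_pos hm, starRate, dif_pos hm']
      have h1 : ((decUpTo k m i ⟨m, hm⟩ : ℕ) : ℝ) = i m.castSucc - 1 := by
        have : decUpTo k m i ⟨m, hm⟩ = i m.castSucc - 1 := by
          simp only [decUpTo, le_refl, if_true]; rfl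
        rw [this, Nat.cast_sub (hi.one_le _), Nat.cast_one]
      have h2 : decUpTo k m i ⟨m + 1, hm'⟩ = i m.succ := by
        simp only [decUpTo, Nat.not_succ_le_self, if_false]; rfl
      rw [h1, h2]
      push_cast
      ring
    · have h1 : ((decUpTo k k i ⟨k, by omega⟩ : ℕ) : ℝ) = i (Fin.last k) - 1 := by
        have : decUpTo k k i ⟨k, by omega⟩ = i (Fin.last k) - 1 := by
          simp only [decUpTo, le_refl, if_true]; rfl
        rw [this, Nat.cast_sub (hi.one_le _), Nat.cast_one]
      have h2 : decUpTo k k i = allDec k i := by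
        funext ℓ
        simp only [decUpTo, allDec, if_pos (Nat.lt_succ_iff.1 ℓ.2)]
      rw [starRate, dif_pos (by omega), starRate, dif_neg (by omega), h1, h2, bcoef_eq]
      ring
  have e2 : ((i 0 : ℝ) - k) * bcoef k δ 0 + δ = starRate k δ i 0 := by
    rw [starRate, dif_pos (by omega)]
    simp
  have e3 : (∀ ℓ : Fin (k + 1), i ℓ = k - (ℓ : ℕ) + 1) ↔ i = birthIdx k := by
    rw [funext_iff]; rfl
  rw [e1, e2, if_congr e3 rfl rfl]

lemma inflow_congr {k : ℕ} {δ : ℝ} {f g : (Fin (k + 1) → ℕ) → ℝ} {i : Fin (k + 1) → ℕ}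
    (hi : ValidIdx k i) (h : ∀ j, j 0 < i 0 → f j = g j) : inflow k δ f i = inflow k δ g i := by
  refine sum_congr rfl fun j _ => ?_
  rw [h]
  have := hi.one_le 0
  simp only [decUpTo, Fin.val_zero, zero_le, if_true]
  omega

lemma inflow_sub_mul {k : ℕ} {δ : ℝ} (f g : (Fin (k + 1) → ℕ) → ℝ) (c : ℝ)
    (i : Fin (k + 1) → ℕ) :
    inflow k δ (fun j => f j - c * g j) i = inflow k δ f i - c * inflow k δ g i := by
  simp only [inflow, mul_sum, ← sum_sub_distrib]
  refine sum_congr rfl fun j _ => ?_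
  ring

lemma inflow_nonneg {k : ℕ} {δ : ℝ} (hδ : -1 < δ) {f : (Fin (k + 1) → ℕ) → ℝ}
    (hf : ∀ j, ¬ ValidIdx k j → f j = 0) {i : Fin (k + 1) → ℕ} (hi : ValidIdx k i)
    (h : ∀ j, j 0 < i 0 → 0 ≤ f j) : 0 ≤ inflow k δ f i := by
  refine sum_nonneg fun j hj => ?_
  by_cases hv : ValidIdx k (decUpTo k j i)
  · refine mul_nonneg (hv.starRate_succ_le hδ (mem_range.1 hj)) (h _ ?_)
    have := hi.one_le 0
    simp only [decUpTo, Fin.val_zero, zero_le, if_true]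
    omega
  · rw [hf _ hv, mul_zero]

/-- The value forced at `i` by the values `f` at smaller indices. -/
def recStep (k : ℕ) (δ : ℝ) (f : (Fin (k + 1) → ℕ) → ℝ) (i : Fin (k + 1) → ℕ) : ℝ :=
  open Classical in
  if ValidIdx k i then
    (inflow k δ f i + if i = birthIdx k then tauc k δ else 0) / (tauc k δ + starRate k δ i 0)
  else 0

lemma limitRecursion_iff_recStep {k : ℕ} {δ : ℝ} (hδ : -1 < δ)
    {p : (Fin (k + 1) → ℕ) → ℝ} : LimitRecursion k δ p ↔ ∀ i, p i = recStep k δ p i := by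
  have hτ := tauc_pos k hδ
  have key : ∀ i, ValidIdx k i → (p i = recStep k δ p i ↔ p i = inflow k δ p i / tauc k δ
        - starRate k δ i 0 / tauc k δ * p i + if i = birthIdx k then 1 else 0) := by
    intro i hi
    have hs := hi.starRate_pos hδ (Nat.succ_pos k)
    rw [recStep, if_pos hi, eq_div_iff (by positivity)]
    have e : (if i = birthIdx k then tauc k δ else 0)
        = tauc k δ * if i = birthIdx k then 1 else 0 := by split_ifs <;> simp
    rw [e]
    generalize (if i = birthIdx k then (1 : ℝ) else 0) = z
    field_simp
    constructor <;> intro h <;> linarith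
  rw [limitRecursion_iff]
  constructor
  · rintro ⟨h1, h2⟩ i
    by_cases hi : ValidIdx k i
    · exact (key i hi).2 (h2 i hi)
    · rw [h1 i hi, recStep, if_neg hi]
  · intro h
    refine ⟨fun i hi => ?_, fun i hi => (key i hi).1 (h i)⟩
    rw [h i, recStep, if_neg hi]

lemma recStep_congr {k : ℕ} {δ : ℝ} {f g : (Fin (k + 1) → ℕ) → ℝ} {i : Fin (k + 1) → ℕ}
    (h : ∀ j, j 0 < i 0 → f j = g j) : recStep k δ f i = recStep k δ g i := by
  by_cases hi : ValidIdx k i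
  · rw [recStep, if_pos hi, recStep, if_pos hi, inflow_congr hi h]
  · rw [recStep, if_neg hi, recStep, if_neg hi]

lemma existsUnique_limitRecursion (k : ℕ) {δ : ℝ} (hδ : -1 < δ) :
    ∃! p : (Fin (k + 1) → ℕ) → ℝ, LimitRecursion k δ p := by
  have hstab : ∀ n m i, i 0 < n → i 0 < m →
      (recStep k δ)^[n] 0 i = (recStep k δ)^[m] 0 i := by
    intro n
    induction n with
    | zero => intro m i h; omega
    | succ n ih =>
      intro m i hn hm
      obtain ⟨m, rfl⟩ : ∃ m', m = m' + 1 := ⟨m - 1, by omega⟩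
      rw [Function.iterate_succ_apply', Function.iterate_succ_apply']
      exact recStep_congr fun j hj => ih m j (by omega) (by omega)
  refine ⟨fun i => (recStep k δ)^[i 0 + 1] 0 i, ?_, ?_⟩
  · change LimitRecursion k δ _
    rw [limitRecursion_iff_recStep hδ]
    intro i
    rw [Function.iterate_succ_apply']
    exact recStep_congr fun j hj => hstab _ _ j hj (by omega)
  · intro q hq
    rw [limitRecursion_iff_recStep hδ] at hq
    have : ∀ n i, i 0 < n → q i = (recStep k δ)^[n] 0 i := by
      intro n
      induction n with
      | zero => intro i h; omega
      | succ n ih =>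
        intro i hn
        rw [Function.iterate_succ_apply', hq]
        exact recStep_congr fun j hj => ih j (by omega)
    exact funext fun i => this _ i (by omega)

lemma LimitRecursion.nonneg {k : ℕ} {δ : ℝ} (hδ : -1 < δ) {p : (Fin (k + 1) → ℕ) → ℝ}
    (hp : LimitRecursion k δ p) (i : Fin (k + 1) → ℕ) : 0 ≤ p i := by
  have hτ := tauc_pos k hδ
  have hrec := (limitRecursion_iff_recStep hδ).1 hp
  induction hn : i 0 using Nat.strong_induction_on generalizing i with
  | _ n ih =>
    subst hn
    rw [hrec i, recStep]
    split_ifs with hi hb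
    · have hs := hi.starRate_pos hδ (Nat.succ_pos k)
      have := inflow_nonneg hδ hp.1 hi fun j hj => ih (j 0) hj j rfl
      positivity
    · have hs := hi.starRate_pos hδ (Nat.succ_pos k)
      have := inflow_nonneg hδ hp.1 hi fun j hj => ih (j 0) hj j rfl
      positivity
    · exact le_rfl

/-! ### Total mass of the limit -/

open Classical in
/-- The valid index vectors all of whose coordinates are at most `D`. -/
def validBox (k D : ℕ) : Finset (Fin (k + 1) → ℕ) :=
  (Fintype.piFinset fun _ => range (D + 1)).filter (ValidIdx k)

lemma mem_validBox {k D : ℕ} {i : Fin (k + 1) → ℕ} :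
    i ∈ validBox k D ↔ ValidIdx k i ∧ i 0 ≤ D := by
  simp only [validBox, mem_filter, Fintype.mem_piFinset, mem_range]
  constructor
  · rintro ⟨h1, h2⟩
    exact ⟨h2, by have := h1 0; omega⟩
  · rintro ⟨h1, h2⟩
    refine ⟨fun ℓ => ?_, h1⟩
    have := h1.2.antitone (Fin.zero_le ℓ)
    omega

/-- Increase the coordinates `0, …, m` of the index vector by one. -/
def incUpTo (k : ℕ) (m : ℕ) (i : Fin (k + 1) → ℕ) : Fin (k + 1) → ℕ :=
  fun ℓ => if (ℓ : ℕ) ≤ m then i ℓ + 1 else i ℓ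

lemma decUpTo_incUpTo (k m : ℕ) (i : Fin (k + 1) → ℕ) : decUpTo k m (incUpTo k m i) = i := by
  funext ℓ
  simp only [decUpTo, incUpTo]
  split_ifs <;> simp

lemma ValidIdx.incUpTo_decUpTo {k : ℕ} {i : Fin (k + 1) → ℕ} (hi : ValidIdx k i) (m : ℕ) :
    incUpTo k m (decUpTo k m i) = i := by
  funext ℓ
  have := hi.one_le ℓ
  simp only [decUpTo, incUpTo]
  split_ifs <;> omega

lemma ValidIdx.incUpTo {k : ℕ} {i : Fin (k + 1) → ℕ} (hi : ValidIdx k i) (m : ℕ) :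
    ValidIdx k (incUpTo k m i) := by
  constructor
  · have := hi.1
    simp only [_root_.incUpTo]
    split_ifs <;> omega
  · intro a b hab
    have h1 := hi.2 hab
    have h2 : (a : ℕ) < b := hab
    simp only [_root_.incUpTo]
    split_ifs <;> omega

lemma sum_validBox_inflow {k : ℕ} {δ : ℝ} {p : (Fin (k + 1) → ℕ) → ℝ}
    (hp : ∀ i, ¬ ValidIdx k i → p i = 0) (D : ℕ) :
    ∑ i ∈ validBox k (D + 1), inflow k δ p i = ∑ i ∈ validBox k D, starRate k δ i 0 * p i := by
  classical
  have h1 : ∀ j, ∑ i ∈ validBox k (D + 1),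
      (starRate k δ (decUpTo k j i) j - starRate k δ (decUpTo k j i) (j + 1))
        * p (decUpTo k j i)
      = ∑ i ∈ validBox k D, (starRate k δ i j - starRate k δ i (j + 1)) * p i := by
    intro j
    rw [← sum_filter_of_ne (p := fun i => ValidIdx k (decUpTo k j i))]
    · refine sum_nbij' (decUpTo k j) (incUpTo k j) ?_ ?_ ?_ ?_ ?_
      · intro i hi
        rw [mem_filter, mem_validBox] at hi
        refine mem_validBox.2 ⟨hi.2, ?_⟩
        have := hi.1.2
        simp only [decUpTo, Fin.val_zero, zero_le, if_true]
        omega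
      · intro i hi
        rw [mem_validBox] at hi
        rw [mem_filter, mem_validBox, decUpTo_incUpTo]
        refine ⟨⟨hi.1.incUpTo j, ?_⟩, hi.1⟩
        simp only [incUpTo, Fin.val_zero, zero_le, if_true]
        omega
      · intro i hi
        rw [mem_filter, mem_validBox] at hi
        exact hi.1.1.incUpTo_decUpTo j
      · intro i _
        exact decUpTo_incUpTo k j i
      · intro i _
        rfl
    · intro i _ hne
      by_contra hv
      exact hne (by rw [hp _ hv, mul_zero])
  simp only [inflow]
  rw [sum_comm, sum_congr rfl fun j _ => h1 j, sum_comm]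
  refine sum_congr rfl fun i _ => ?_
  rw [← sum_mul, sum_starRate_sub]

/-- The mass of the limit beyond a box decays by an explicit factor with the size of the box. -/
lemma LimitRecursion.mass_succ {k : ℕ} {δ : ℝ} (hδ : -1 < δ) {p : (Fin (k + 1) → ℕ) → ℝ}
    (hp : LimitRecursion k δ p) (n : ℕ) :
    (1 - ∑ i ∈ validBox k (k + (n + 1)), p i)
        * (1 + (((n : ℝ) + 1) * bcoef k δ 0 + δ) / tauc k δ)
      = (((n : ℝ) + 1) * bcoef k δ 0 + δ) / tauc k δ * (1 - ∑ i ∈ validBox k (k + n), p i) := by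
  classical
  have hτ := tauc_pos k hδ
  have hrec := (limitRecursion_iff.1 hp).2
  have hsub : validBox k (k + n) ⊆ validBox k (k + (n + 1)) := by
    intro i hi
    rw [mem_validBox] at hi ⊢
    exact ⟨hi.1, by omega⟩
  have h1 : ∑ i ∈ validBox k (k + (n + 1)), p i
      = (∑ i ∈ validBox k (k + n), starRate k δ i 0 * p i) / tauc k δ
        - (∑ i ∈ validBox k (k + (n + 1)), starRate k δ i 0 * p i) / tauc k δ + 1 := by
    rw [← sum_validBox_inflow hp.1, sum_congr rfl fun i hi => hrec i (mem_validBox.1 hi).1]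
    rw [sum_add_distrib, sum_sub_distrib, sum_ite_eq', if_pos, add_left_inj, sum_div, sum_div]
    · congr 1
      refine sum_congr rfl fun i _ => ?_
      ring
    · refine mem_validBox.2 ⟨validIdx_birthIdx k, ?_⟩
      simp [birthIdx]
  have h2 : ∑ i ∈ validBox k (k + (n + 1)), starRate k δ i 0 * p i
      - ∑ i ∈ validBox k (k + n), starRate k δ i 0 * p i
      = (((n : ℝ) + 1) * bcoef k δ 0 + δ) * (∑ i ∈ validBox k (k + (n + 1)), p i
        - ∑ i ∈ validBox k (k + n), p i) := by
    rw [← sum_sdiff hsub, ← sum_sdiff hsub, add_sub_cancel_right, add_sub_cancel_right, mul_sum]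
    refine sum_congr rfl fun i hi => ?_
    rw [Finset.mem_sdiff, mem_validBox, mem_validBox] at hi
    have h0 : i 0 = k + (n + 1) := by
      have := hi.1.2
      by_contra h
      exact hi.2 ⟨hi.1.1, by omega⟩
    rw [starRate, dif_pos (Nat.succ_pos k)]
    have h0' : i ⟨0, Nat.succ_pos k⟩ = k + (n + 1) := h0
    rw [h0']
    push_cast
    ring
  set Q := ∑ i ∈ validBox k (k + n), p i
  set Q' := ∑ i ∈ validBox k (k + (n + 1)), p i
  set R := ∑ i ∈ validBox k (k + n), starRate k δ i 0 * p i
  set R' := ∑ i ∈ validBox k (k + (n + 1)), starRate k δ i 0 * p i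
  have h3 : (Q' - 1) * tauc k δ = -(((n : ℝ) + 1) * bcoef k δ 0 + δ) * (Q' - Q) := by
    rw [neg_mul, ← h2, h1]
    field_simp
    ring
  field_simp
  linarith

lemma tendsto_zero_of_ratio {r f : ℕ → ℝ} {C : ℝ} (hr : r 0 = 1) (hf : ∀ n, 0 < f n)
    (hfC : ∀ n : ℕ, f n ≤ C * ((n : ℝ) + 1)) (h : ∀ n, r (n + 1) * (1 + f n) = f n * r n) :
    Tendsto r atTop (nhds 0) := by
  have hC : 0 < C := by
    have := (hf 0).trans_le (hfC 0)
    simpa using this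
  have hnn : ∀ n, 0 ≤ r n := by
    intro n
    induction n with
    | zero => rw [hr]; exact zero_le_one
    | succ n ih =>
      have h1 : r (n + 1) = f n * r n / (1 + f n) := by
        rw [eq_div_iff (by linarith [hf n]), h]
      rw [h1]
      have := hf n
      positivity
  have hle : ∀ n, r n * (1 + ∑ m ∈ range n, 1 / f m) ≤ 1 := by
    intro n
    induction n with
    | zero => simp [hr]
    | succ n ih =>
      have hfn := hf n
      have h1 : r (n + 1) * (1 + 1 / f n) = r n := by
        have := h n
        field_simp
        linarith
      have h2 : r (n + 1) ≤ r n := by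
        rw [← h1]
        have : 0 ≤ r (n + 1) * (1 / f n) := mul_nonneg (hnn _) (by positivity)
        linarith
      have h3 : 0 ≤ ∑ m ∈ range n, 1 / f m :=
        sum_nonneg fun m _ => (one_div_pos.2 (hf m)).le
      rw [sum_range_succ]
      nlinarith [mul_le_mul_of_nonneg_right h2 h3]
  have hdiv : Tendsto (fun n : ℕ => 1 + C⁻¹ * ∑ m ∈ range n, 1 / ((m : ℝ) + 1)) atTop atTop :=
    tendsto_atTop_add_const_left _ _
      (Real.tendsto_sum_range_one_div_nat_succ_atTop.const_mul_atTop (inv_pos.2 hC))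
  refine squeeze_zero hnn (fun n => ?_) hdiv.inv_tendsto_atTop
  have hpos : 0 < 1 + C⁻¹ * ∑ m ∈ range n, 1 / ((m : ℝ) + 1) := by
    have : 0 ≤ ∑ m ∈ range n, 1 / ((m : ℝ) + 1) := sum_nonneg fun m _ => by positivity
    have hC' := inv_pos.2 hC
    nlinarith [mul_nonneg hC'.le this]
  rw [Pi.inv_apply, ← one_div, le_div_iff₀ hpos]
  refine le_trans (mul_le_mul_of_nonneg_left ?_ (hnn n)) (hle n)
  rw [add_le_add_iff_left, mul_sum]
  refine sum_le_sum fun m _ => ?_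
  have := hf m
  rw [← one_div, one_div_mul_one_div]
  exact one_div_le_one_div_of_le this (hfC m)

lemma LimitRecursion.hasSum {k : ℕ} {δ : ℝ} (hδ : -1 < δ) {p : (Fin (k + 1) → ℕ) → ℝ}
    (hp : LimitRecursion k δ p) : HasSum p 1 := by
  have hτ := tauc_pos k hδ
  have hb := one_le_bcoef hδ (Nat.zero_le k)
  have hr : Tendsto (fun n => 1 - ∑ i ∈ validBox k (k + n), p i) atTop (nhds 0) := by
    refine tendsto_zero_of_ratio
      (f := fun n => (((n : ℝ) + 1) * bcoef k δ 0 + δ) / tauc k δ)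
      (C := (bcoef k δ 0 + |δ|) / tauc k δ) ?_ ?_ ?_ (hp.mass_succ hδ)
    · have : validBox k (k + 0) = ∅ := by
        rw [eq_empty_iff_forall_notMem]
        intro i hi
        rw [mem_validBox] at hi
        have := hi.1.sub_le 0
        simp only [Fin.val_zero] at this
        omega
      rw [this]
      simp
    · intro n
      have : (0 : ℝ) ≤ n := Nat.cast_nonneg n
      refine div_pos ?_ hτ
      nlinarith
    · intro n
      have : (0 : ℝ) ≤ n := Nat.cast_nonneg n
      rw [div_mul_eq_mul_div]
      refine div_le_div_of_nonneg_right ?_ hτ.le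
      nlinarith [le_abs_self δ, abs_nonneg δ]
  have hQ : Tendsto (fun n => ∑ i ∈ validBox k (k + n), p i) atTop (nhds 1) := by
    simpa using hr.const_sub 1
  let T : ℕ → Finset (Fin (k + 1) → ℕ) := fun n => Fintype.piFinset fun _ => range (k + n + 1)
  have hT : Tendsto T atTop atTop := by
    refine tendsto_atTop_finset_of_monotone ?_ ?_
    · intro a b hab i hi
      simp only [T, Fintype.mem_piFinset, mem_range] at hi ⊢
      exact fun ℓ => (hi ℓ).trans_le (by omega)
    · intro i
      refine ⟨∑ ℓ, i ℓ, ?_⟩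
      simp only [T, Fintype.mem_piFinset, mem_range]
      intro ℓ
      have := single_le_sum (f := i) (fun _ _ => Nat.zero_le _) (mem_univ ℓ)
      omega
  have hmono : Monotone fun s : Finset (Fin (k + 1) → ℕ) => ∑ i ∈ s, p i :=
    fun s t hst => sum_le_sum_of_subset_of_nonneg hst fun i _ _ => hp.nonneg hδ i
  refine (tendsto_iff_tendsto_subseq_of_monotone hmono hT).2 ?_
  refine hQ.congr fun n => ?_
  refine sum_subset (fun i hi => Fintype.mem_piFinset.2 fun ℓ => ?_)
    fun i hi hi' => hp.1 i fun hv => hi' (mem_validBox.2 ⟨hv, ?_⟩)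
  · rw [mem_validBox] at hi
    have := hi.1.2.antitone (Fin.zero_le ℓ)
    rw [mem_range]
    omega
  · have := mem_range.1 (Fintype.mem_piFinset.1 hi 0)
    omega

/-! ### The random process -/

lemma initComplex_eq_addSimplex (k : ℕ) :
    initComplex k = addSimplex ((Icc 1 (k + 1)).powerset.filter (·.Nonempty))
      (Icc 1 (k + 1)) (0 + k + 2) := by
  have h : insert (0 + k + 2) (Icc 1 (k + 1)) = Icc 1 (k + 2) := by
    ext v
    simp only [Finset.mem_insert, Finset.mem_Icc]
    omega
  rw [initComplex, addSimplex, h]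
  refine (union_eq_right.2 (filter_subset_filter _ (powerset_mono.2 ?_))).symm
  exact Icc_subset_Icc le_rfl (by omega)

namespace PAComplex

variable {k : ℕ} {δ : ℝ} {Ω : Type*} [MeasurableSpace Ω] (M : PAComplex k δ Ω)

lemma G_succ (n : ℕ) (ω : Ω) :
    M.G (n + 1) ω = addSimplex (M.G n ω) (M.choice (n + 1) ω) (n + 1 + k + 2) :=
  M.step (n + 1) ω (Nat.le_add_left 1 n)

lemma choice_succ_mem (n : ℕ) (ω : Ω) : M.choice (n + 1) ω ∈ kSimplices k (M.G n ω) :=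
  M.choice_mem (n + 1) ω (Nat.le_add_left 1 n)

lemma reachable (n : ℕ) (ω : Ω) : Reachable k (n + 1) (M.G n ω) := by
  induction n with
  | zero =>
    rw [M.init, initComplex_eq_addSimplex]
    refine Reachable.zero.succ ?_
    rw [kSimplices_simplex, Finset.mem_singleton]
  | succ n ih =>
    rw [G_succ]
    exact ih.succ (M.choice_succ_mem n ω)

/-- The history of the process can be read off from its current state. -/
lemma filter_G (ω : Ω) {j n : ℕ} (hjn : j ≤ n) :
    (M.G n ω).filter (· ⊆ Icc 1 (j + k + 2)) = M.G j ω := by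
  induction n, hjn using Nat.le_induction with
  | base =>
    refine filter_true_of_mem fun t ht => ?_
    have := ((M.reachable j ω).subset_Icc t ht).2
    rwa [show j + 1 + k + 1 = j + k + 2 by ring] at this
  | succ n hjn ih =>
    rw [← ih, G_succ]
    ext t
    simp only [addSimplex, Finset.mem_filter, Finset.mem_union, Finset.mem_powerset]
    refine ⟨fun h => ⟨?_, h.2⟩, fun h => ⟨Or.inl h.1, h.2⟩⟩
    rcases h.1 with h1 | h1
    · exact h1
    · have hs := mem_kSimplices.1 (M.choice_succ_mem n ω)
      refine (M.reachable n ω).down_closed _ hs.1 t (fun v hv => ?_) h1.2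
      refine (Finset.mem_insert.1 (h1.1 hv)).resolve_left fun hv' => ?_
      have := Finset.mem_Icc.1 (h.2 hv)
      omega

/-- A finite set containing all the possible states of the process at time `n`. -/
def states (k n : ℕ) : Finset (Finset (Finset ℕ)) := (Icc 1 (n + k + 2)).powerset.powerset

lemma G_mem_states (n : ℕ) (ω : Ω) : M.G n ω ∈ states k n := by
  refine Finset.mem_powerset.2 fun t ht => Finset.mem_powerset.2 ?_
  have := ((M.reachable n ω).subset_Icc t ht).2
  rwa [show n + 1 + k + 1 = n + k + 2 by ring] at this

lemma measurableSet_G_eq (n : ℕ) (g : Finset (Finset ℕ)) :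
    MeasurableSet {ω | M.G n ω = g} :=
  M.meas_G n (MeasurableSpace.measurableSet_top (s := {g}))

lemma measurableSet_choice_eq (n : ℕ) (r : Finset ℕ) (m : ℕ) (g : Finset (Finset ℕ)) :
    MeasurableSet {ω | M.choice n ω = r ∧ M.G m ω = g} :=
  (M.meas_choice n (MeasurableSpace.measurableSet_top (s := {r}))).inter
    (M.measurableSet_G_eq m g)

lemma comp_G_eq_sum (n : ℕ) (F : Finset (Finset ℕ) → ℝ) (ω : Ω) :
    F (M.G n ω) = ∑ g ∈ states k n, {ω | M.G n ω = g}.indicator (fun _ => F g) ω := by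
  rw [sum_eq_single_of_mem _ (M.G_mem_states n ω)]
  · rw [Set.indicator_of_mem (by exact rfl)]
  · intro g _ hg
    exact Set.indicator_of_notMem (fun h => hg (Eq.symm h)) _

lemma integrable_comp_G (n : ℕ) (F : Finset (Finset ℕ) → ℝ) :
    Integrable (fun ω => F (M.G n ω)) M.μ := by
  have := M.isProb
  simp_rw [M.comp_G_eq_sum n F]
  exact integrable_finsetSum _ fun g _ =>
    (integrable_const (F g)).indicator (M.measurableSet_G_eq n g)

lemma integral_comp_G (n : ℕ) (F : Finset (Finset ℕ) → ℝ) :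
    ∫ ω, F (M.G n ω) ∂M.μ = ∑ g ∈ states k n, M.μ.real {ω | M.G n ω = g} * F g := by
  have := M.isProb
  simp_rw [M.comp_G_eq_sum n F]
  rw [integral_finsetSum _ fun g _ =>
    (integrable_const (F g)).indicator (M.measurableSet_G_eq n g)]
  refine sum_congr rfl fun g _ => ?_
  rw [integral_indicator_const _ (M.measurableSet_G_eq n g), smul_eq_mul]

/-- The choice of the attachment simplex is Markovian. -/
lemma measureReal_choice (hδ : -1 < δ) (n : ℕ) (g : Finset (Finset ℕ)) {r : Finset ℕ}
    (hr : r ∈ kSimplices k g) :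
    M.μ.real {ω | M.choice (n + 1) ω = r ∧ M.G n ω = g}
      = M.μ.real {ω | M.G n ω = g} *
        (((simDeg k g r : ℝ) + δ) / ∑ t ∈ kSimplices k g, ((simDeg k g t : ℝ) + δ)) := by
  by_cases h : ∃ ω, M.G n ω = g
  · obtain ⟨ω₀, rfl⟩ := h
    have hist : ∀ ω, (∀ j < n + 1, M.G j ω = M.G j ω₀) ↔ M.G n ω = M.G n ω₀ := by
      refine fun ω => ⟨fun h => h n n.lt_succ_self, fun h j hj => ?_⟩
      rw [← M.filter_G ω (Nat.lt_succ_iff.1 hj), h, M.filter_G ω₀ (Nat.lt_succ_iff.1 hj)]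
    have hpos : ∀ t ∈ kSimplices k (M.G n ω₀), 0 ≤ (simDeg k (M.G n ω₀) t : ℝ) + δ := by
      intro t ht
      have := (M.reachable n ω₀).one_le_simDeg n.succ_ne_zero ht
      have : (1 : ℝ) ≤ simDeg k (M.G n ω₀) t := by exact_mod_cast this
      linarith
    have := M.cond_law (n + 1) (Nat.le_add_left 1 n) (fun j => M.G j ω₀) r hr
    simp only [hist, Nat.add_sub_cancel] at this
    rw [measureReal_def, this, ENNReal.toReal_mul, ENNReal.toReal_ofReal, mul_comm]
    · rfl
    · exact div_nonneg (hpos r hr) (sum_nonneg hpos)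
  · push Not at h
    simp [h]

/-- One step of the Markov chain of complexes. -/
lemma integral_comp_G_succ (hδ : -1 < δ) (n : ℕ) (F : Finset (Finset ℕ) → ℝ) :
    ∫ ω, F (M.G (n + 1) ω) ∂M.μ
      = ∫ ω, (∑ r ∈ kSimplices k (M.G n ω), ((simDeg k (M.G n ω) r : ℝ) + δ) *
          F (addSimplex (M.G n ω) r (n + 1 + k + 2))) /
          ∑ t ∈ kSimplices k (M.G n ω), ((simDeg k (M.G n ω) t : ℝ) + δ) ∂M.μ := by
  have := M.isProb
  have key : ∀ ω, F (M.G (n + 1) ω) = ∑ g ∈ states k n, ∑ r ∈ kSimplices k g,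
      {ω | M.choice (n + 1) ω = r ∧ M.G n ω = g}.indicator
        (fun _ => F (addSimplex g r (n + 1 + k + 2))) ω := by
    intro ω
    rw [sum_eq_single_of_mem _ (M.G_mem_states n ω), sum_eq_single_of_mem _
      (M.choice_succ_mem n ω), Set.indicator_of_mem, G_succ]
    · exact ⟨rfl, rfl⟩
    · exact fun r _ hr => Set.indicator_of_notMem (fun h => hr h.1.symm) _
    · exact fun g _ hg => sum_eq_zero fun r _ =>
        Set.indicator_of_notMem (fun h => hg h.2.symm) _
  have hint : ∀ g r, Integrable ({ω | M.choice (n + 1) ω = r ∧ M.G n ω = g}.indicator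
      (fun _ => F (addSimplex g r (n + 1 + k + 2)))) M.μ := fun g r =>
    (integrable_const _).indicator (M.measurableSet_choice_eq _ r n g)
  rw [M.integral_comp_G n fun g => (∑ r ∈ kSimplices k g, ((simDeg k g r : ℝ) + δ) *
    F (addSimplex g r (n + 1 + k + 2))) / ∑ t ∈ kSimplices k g, ((simDeg k g t : ℝ) + δ)]
  simp_rw [key]
  rw [integral_finsetSum _ fun g _ => integrable_finsetSum _ fun r _ => hint g r]
  refine sum_congr rfl fun g _ => ?_
  rw [integral_finsetSum _ fun r _ => hint g r, sum_div, mul_sum]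
  refine sum_congr rfl fun r hr => ?_
  rw [integral_indicator_const _ (M.measurableSet_choice_eq _ r n g), smul_eq_mul,
    M.measureReal_choice hδ n g hr]
  ring

end PAComplex

/-- Interpolation between the squares, for sequences with bounded increments. -/
lemma tendsto_div_of_tendsto_sq {u : ℕ → ℝ} {C l : ℝ} (hC : ∀ n, |u (n + 1) - u n| ≤ C)
    (h : Tendsto (fun m : ℕ => u ((m + 1) ^ 2) / ((m : ℝ) + 1) ^ 2) atTop (nhds l)) :
    Tendsto (fun n : ℕ => u n / n) atTop (nhds l) := by
  have key : Tendsto (fun n : ℕ => (u n + C * n) / n) atTop (nhds (l + C)) := by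
    refine tendsto_div_of_monotone_of_exists_subseq_tendsto_div _ _ ?_ fun a ha => ?_
    · refine monotone_nat_of_le_succ fun n => ?_
      have := (abs_le.1 (hC n)).1
      push_cast
      linarith
    · refine ⟨fun m => (m + 1) ^ 2, ?_, ?_, ?_⟩
      · have h1 : Tendsto (fun m : ℕ => (1 + 1 / ((m : ℝ) + 1)) ^ 2) atTop (nhds 1) := by
          have := (tendsto_one_div_add_atTop_nhds_zero_nat (𝕜 := ℝ)).const_add 1 |>.pow 2
          simpa using this
        filter_upwards [h1.eventually (ge_mem_nhds ha)] with m hm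
        have h2 : ((m : ℝ) + 1 + 1) ^ 2 = (1 + 1 / ((m : ℝ) + 1)) ^ 2 * ((m : ℝ) + 1) ^ 2 := by
          field_simp
        push_cast
        rw [h2]
        exact mul_le_mul_of_nonneg_right hm (by positivity)
      · exact (tendsto_pow_atTop two_ne_zero).comp (tendsto_add_atTop_nat 1)
      · refine (h.add_const C).congr fun m => ?_
        push_cast
        field_simp
  have h1 := key.sub_const C
  rw [add_sub_cancel_right] at h1
  refine h1.congr' ?_
  filter_upwards [eventually_gt_atTop 0] with n hn
  have : (n : ℝ) ≠ 0 := by positivity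
  field_simp
  ring

/-- The deviation of the degree count from its predicted value. -/
def deviation (k : ℕ) (p : (Fin (k + 1) → ℕ) → ℝ) (i : Fin (k + 1) → ℕ) (n : ℕ)
    (g : Finset (Finset ℕ)) : ℝ :=
  Ncount k g i - (1 + ((n : ℝ) + 1) * (k + 1)) * p i

lemma Reachable.abs_deviation_sub_le {k n : ℕ} {g : Finset (Finset ℕ)}
    (h : Reachable k (n + 1) g) {r : Finset ℕ} (hr : r ∈ kSimplices k g)
    (p : (Fin (k + 1) → ℕ) → ℝ) (i : Fin (k + 1) → ℕ) :
    |deviation k p i (n + 1) (addSimplex g r (n + 1 + k + 2)) - deviation k p i n g|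
      ≤ (k + 1) * (k + 2) + (k + 1) * |p i| := by
  have h2 : deviation k p i (n + 1) (addSimplex g r (n + 1 + k + 2)) - deviation k p i n g
      = ((Ncount k (addSimplex g r (n + 1 + k + 2)) i : ℝ) - Ncount k g i)
        - ((k : ℝ) + 1) * p i := by
    rw [deviation, deviation]
    push_cast
    ring
  rw [h2]
  refine (abs_sub _ _).trans (add_le_add (h.abs_Ncount_sub_le hr i) ?_)
  rw [abs_mul, abs_of_nonneg (by positivity : (0 : ℝ) ≤ (k : ℝ) + 1)]

/-- Rescaled conditional drift of the deviation, without its mean-reverting part. -/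
def drift (k : ℕ) (δ : ℝ) (p : (Fin (k + 1) → ℕ) → ℝ) (i : Fin (k + 1) → ℕ) (n : ℕ)
    (g : Finset (Finset ℕ)) : ℝ :=
  inflow k δ (fun j => deviation k p j n g) i
    + (inflow k δ p i - starRate k δ i 0 * p i) * ((tauc k δ - (k + 1) * δ) / tauc k δ)

lemma exists_weight_lower_bound (k : ℕ) {δ : ℝ} (hδ : -1 < δ) :
    ∃ κ : ℝ, 0 < κ ∧ ∀ n : ℕ, κ * ((n : ℝ) + 1) ≤ ((n : ℝ) + 1) * tauc k δ + δ := by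
  have hτ := tauc_pos k hδ
  have h1 : 0 < tauc k δ + δ := by
    have : (0 : ℝ) ≤ k := Nat.cast_nonneg k
    rw [tauc]
    nlinarith
  refine ⟨min (tauc k δ) (tauc k δ + δ), lt_min hτ h1, fun n => ?_⟩
  have hn : (0 : ℝ) ≤ n := Nat.cast_nonneg n
  have h2 := min_le_left (tauc k δ) (tauc k δ + δ)
  have h3 := min_le_right (tauc k δ) (tauc k δ + δ)
  nlinarith

/-- The conditional mean of the increment of the deviation. -/
lemma Reachable.sum_weight_deviation_sub {k n : ℕ} {δ : ℝ} (hδ : -1 < δ)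
    {g : Finset (Finset ℕ)} (h : Reachable k (n + 1) g)
    {p : (Fin (k + 1) → ℕ) → ℝ} (hp : LimitRecursion k δ p) {i : Fin (k + 1) → ℕ}
    (hi : ValidIdx k i) :
    ∑ r ∈ kSimplices k g, ((simDeg k g r : ℝ) + δ) *
        (deviation k p i (n + 1) (addSimplex g r (n + 1 + k + 2)) - deviation k p i n g)
      = drift k δ p i n g - starRate k δ i 0 * deviation k p i n g := by
  have hτ := (tauc_pos k hδ).ne'
  have h1 := h.sum_weight_Ncount δ hi.one_le
  have h2 := h.sum_weight δ
  have h3 := (limitRecursion_iff.1 hp).2 i hi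
  have h4 : ∑ r ∈ kSimplices k g, ((simDeg k g r : ℝ) + δ) *
        (deviation k p i (n + 1) (addSimplex g r (n + 1 + k + 2)) - deviation k p i n g)
      = ∑ r ∈ kSimplices k g, ((simDeg k g r : ℝ) + δ)
          * (Ncount k (addSimplex g r (n + 1 + k + 2)) i : ℝ)
        - (∑ r ∈ kSimplices k g, ((simDeg k g r : ℝ) + δ)) * (Ncount k g i + (k + 1) * p i) := by
    rw [sum_mul, ← sum_sub_distrib]
    refine sum_congr rfl fun r _ => ?_
    simp only [deviation]
    push_cast
    ring
  have h5 : inflow k δ (fun j => deviation k p j n g) i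
      = inflow k δ (fun j => (Ncount k g j : ℝ)) i
        - (1 + ((n : ℝ) + 1) * (k + 1)) * inflow k δ p i :=
    inflow_sub_mul _ _ _ _
  have h6 : (if i = birthIdx k then (k : ℝ) + 1 else 0)
      = (k + 1) * if i = birthIdx k then 1 else 0 := by
    simp
  rw [h4, h1, h2, drift, h5, deviation, h6]
  have h7 : (if i = birthIdx k then (1 : ℝ) else 0)
      = p i - inflow k δ p i / tauc k δ + starRate k δ i 0 / tauc k δ * p i := by
    linarith
  rw [h7]
  push_cast
  field_simp
  ring

/-- The conditional second moment of the deviation grows slowly. -/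
lemma Reachable.sum_weight_deviation_sq_le {k n : ℕ} {δ : ℝ} (hδ : -1 < δ)
    {g : Finset (Finset ℕ)} (h : Reachable k (n + 1) g)
    {p : (Fin (k + 1) → ℕ) → ℝ} (hp : LimitRecursion k δ p) {i : Fin (k + 1) → ℕ}
    (hi : ValidIdx k i) {κ : ℝ} (hκ : 0 < κ)
    (hκn : κ * ((n : ℝ) + 1) ≤ ((n : ℝ) + 1) * tauc k δ + δ) :
    (∑ r ∈ kSimplices k g, ((simDeg k g r : ℝ) + δ) *
        deviation k p i (n + 1) (addSimplex g r (n + 1 + k + 2)) ^ 2) /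
        ∑ t ∈ kSimplices k g, ((simDeg k g t : ℝ) + δ)
      ≤ (1 + 1 / (2 * ((n : ℝ) + 1))) * deviation k p i n g ^ 2
        + 2 / (κ ^ 2 * ((n : ℝ) + 1)) * drift k δ p i n g ^ 2
        + ((k + 1) * (k + 2) + (k + 1) * |p i|) ^ 2 := by
  set C : ℝ := (k + 1) * (k + 2) + (k + 1) * |p i|
  set y := deviation k p i n g
  set z := drift k δ p i n g
  have hn : (0 : ℝ) < (n : ℝ) + 1 := by positivity
  have hpos : ∀ t ∈ kSimplices k g, 0 ≤ (simDeg k g t : ℝ) + δ := by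
    intro t ht
    have : (1 : ℝ) ≤ simDeg k g t := by exact_mod_cast h.one_le_simDeg n.succ_ne_zero ht
    linarith
  have hW := h.sum_weight δ
  push_cast at hW
  have hW0 : 0 < ((n : ℝ) + 1) * tauc k δ + δ := lt_of_lt_of_le (by positivity) hκn
  have hD : ∀ r ∈ kSimplices k g, ((simDeg k g r : ℝ) + δ) *
        deviation k p i (n + 1) (addSimplex g r (n + 1 + k + 2)) ^ 2
      ≤ ((simDeg k g r : ℝ) + δ) * (y ^ 2 + C ^ 2) + 2 * y * (((simDeg k g r : ℝ) + δ) *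
        (deviation k p i (n + 1) (addSimplex g r (n + 1 + k + 2)) - y)) := by
    intro r hr
    set x := deviation k p i (n + 1) (addSimplex g r (n + 1 + k + 2))
    have hxy : |x - y| ≤ C := h.abs_deviation_sub_le hr p i
    have h3 : (x - y) ^ 2 ≤ C ^ 2 := sq_le_sq' (abs_le.1 hxy).1 (abs_le.1 hxy).2
    nlinarith [hpos r hr, mul_le_mul_of_nonneg_left h3 (hpos r hr)]
  have hsum := sum_le_sum hD
  rw [sum_add_distrib, ← sum_mul, ← mul_sum, h.sum_weight_deviation_sub hδ hp hi, hW] at hsum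
  rw [hW, div_le_iff₀ hW0]
  refine hsum.trans ?_
  have ho : 0 ≤ starRate k δ i 0 := (hi.starRate_pos hδ (Nat.succ_pos k)).le
  have h8 : 2 * y * z ≤ (1 / (2 * ((n : ℝ) + 1)) * y ^ 2 + 2 / (κ ^ 2 * ((n : ℝ) + 1)) * z ^ 2)
      * (κ * ((n : ℝ) + 1)) := by
    have : (1 / (2 * ((n : ℝ) + 1)) * y ^ 2 + 2 / (κ ^ 2 * ((n : ℝ) + 1)) * z ^ 2)
      * (κ * ((n : ℝ) + 1)) - 2 * y * z = (κ * y - 2 * z) ^ 2 / (2 * κ) := by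
      field_simp
      ring
    have h9 : 0 ≤ (κ * y - 2 * z) ^ 2 / (2 * κ) := by positivity
    linarith
  have h10 := mul_le_mul_of_nonneg_left hκn
    (by positivity : 0 ≤ 1 / (2 * ((n : ℝ) + 1)) * y ^ 2 + 2 / (κ ^ 2 * ((n : ℝ) + 1)) * z ^ 2)
  nlinarith [mul_nonneg ho (sq_nonneg y)]

namespace PAComplex

variable {k : ℕ} {δ : ℝ} {Ω : Type*} [MeasurableSpace Ω] (M : PAComplex k δ Ω)

/-- The second moments of the functionals `Y n` of the complexes grow at most linearly. -/
def SqLinear (Y : ℕ → Finset (Finset ℕ) → ℝ) : Prop :=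
  ∃ K : ℝ, 0 ≤ K ∧ ∀ n : ℕ, ∫ ω, Y n (M.G n ω) ^ 2 ∂M.μ ≤ K * ((n : ℝ) + 1)

variable {M}

lemma SqLinear.const (c : ℝ) : M.SqLinear fun _ _ => c := by
  have := M.isProb
  refine ⟨c ^ 2, sq_nonneg c, fun n => ?_⟩
  rw [integral_const, probReal_univ, one_smul]
  have : (0 : ℝ) ≤ n := Nat.cast_nonneg n
  nlinarith [sq_nonneg c]

lemma SqLinear.const_mul {Y : ℕ → Finset (Finset ℕ) → ℝ} (h : M.SqLinear Y) (c : ℝ) :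
    M.SqLinear fun n g => c * Y n g := by
  obtain ⟨K, hK, h⟩ := h
  refine ⟨c ^ 2 * K, by positivity, fun n => ?_⟩
  simp_rw [mul_pow]
  rw [integral_const_mul, mul_assoc]
  exact mul_le_mul_of_nonneg_left (h n) (sq_nonneg c)

lemma SqLinear.add {Y Z : ℕ → Finset (Finset ℕ) → ℝ} (hY : M.SqLinear Y) (hZ : M.SqLinear Z) :
    M.SqLinear fun n g => Y n g + Z n g := by
  obtain ⟨K, hK, hY⟩ := hY
  obtain ⟨L, hL, hZ⟩ := hZ
  refine ⟨2 * K + 2 * L, by positivity, fun n => ?_⟩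
  have hiY := (M.integrable_comp_G n fun g => Y n g ^ 2).const_mul 2
  have hiZ := (M.integrable_comp_G n fun g => Z n g ^ 2).const_mul 2
  refine (integral_mono (M.integrable_comp_G n fun g => (Y n g + Z n g) ^ 2)
    (hiY.add hiZ) fun ω => ?_).trans (?_ : _ ≤ _)
  · simp only [Pi.add_apply]
    nlinarith [sq_nonneg (Y n (M.G n ω) - Z n (M.G n ω))]
  · rw [integral_add' hiY hiZ, integral_const_mul, integral_const_mul]
    linarith [hY n, hZ n]

lemma SqLinear.sum {ι : Type*} {s : Finset ι} {Y : ι → ℕ → Finset (Finset ℕ) → ℝ}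
    (h : ∀ j ∈ s, M.SqLinear (Y j)) : M.SqLinear fun n g => ∑ j ∈ s, Y j n g := by
  classical
  induction s using Finset.induction_on with
  | empty => simpa using SqLinear.const (M := M) 0
  | insert j s hj ih =>
    simp only [sum_insert hj]
    exact (h j (mem_insert_self j s)).add (ih fun l hl => h l (mem_insert_of_mem hl))

lemma SqLinear.deviation_of_drift (hδ : -1 < δ) {p : (Fin (k + 1) → ℕ) → ℝ}
    (hp : LimitRecursion k δ p) {i : Fin (k + 1) → ℕ} (hi : ValidIdx k i)
    (h : M.SqLinear (drift k δ p i)) : M.SqLinear (deviation k p i) := by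
  obtain ⟨B, hB, h⟩ := h
  obtain ⟨κ, hκ, hκn⟩ := exists_weight_lower_bound k hδ
  set C : ℝ := (k + 1) * (k + 2) + (k + 1) * |p i|
  set L := ∫ ω, deviation k p i 0 (M.G 0 ω) ^ 2 ∂M.μ
  have hL : 0 ≤ L := integral_nonneg fun ω => sq_nonneg _
  refine ⟨L + 2 * (2 * B / κ ^ 2 + C ^ 2), by positivity, fun n => ?_⟩
  set K := L + 2 * (2 * B / κ ^ 2 + C ^ 2)
  have hK0 : 0 ≤ 2 * B / κ ^ 2 + C ^ 2 := by positivity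
  induction n with
  | zero =>
    simp only [Nat.cast_zero, zero_add, mul_one]
    linarith
  | succ n ih =>
    have := M.isProb
    have hn : (0 : ℝ) < (n : ℝ) + 1 := by positivity
    have hi1 := (M.integrable_comp_G n fun g => deviation k p i n g ^ 2).const_mul
      (1 + 1 / (2 * ((n : ℝ) + 1)))
    have hi2 := (M.integrable_comp_G n fun g => drift k δ p i n g ^ 2).const_mul
      (2 / (κ ^ 2 * ((n : ℝ) + 1)))
    rw [M.integral_comp_G_succ hδ n fun g => deviation k p i (n + 1) g ^ 2]
    refine (integral_mono (M.integrable_comp_G n fun g => (∑ r ∈ kSimplices k g,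
      ((simDeg k g r : ℝ) + δ) * deviation k p i (n + 1) (addSimplex g r (n + 1 + k + 2)) ^ 2) /
        ∑ t ∈ kSimplices k g, ((simDeg k g t : ℝ) + δ)) ((hi1.add hi2).add
        (integrable_const (C ^ 2))) fun ω =>
          (M.reachable n ω).sum_weight_deviation_sq_le hδ hp hi hκ (hκn n)).trans ?_
    rw [integral_add' (hi1.add hi2) (integrable_const _), integral_add' hi1 hi2,
      integral_const_mul, integral_const_mul, integral_const, probReal_univ, one_smul]
    have h1 := mul_le_mul_of_nonneg_left ih
      (by positivity : 0 ≤ 1 + 1 / (2 * ((n : ℝ) + 1)))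
    have h2 := mul_le_mul_of_nonneg_left (h n)
      (by positivity : 0 ≤ 2 / (κ ^ 2 * ((n : ℝ) + 1)))
    have h3 : (1 + 1 / (2 * ((n : ℝ) + 1))) * (K * ((n : ℝ) + 1)) = K * (n + 1) + K / 2 := by
      field_simp
    have h4 : 2 / (κ ^ 2 * ((n : ℝ) + 1)) * (B * ((n : ℝ) + 1)) = 2 * B / κ ^ 2 := by
      field_simp
    push_cast
    linarith

/-- The deviations have linearly growing second moments. -/
lemma sqLinear_deviation (M : PAComplex k δ Ω) (hδ : -1 < δ) {p : (Fin (k + 1) → ℕ) → ℝ}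
    (hp : LimitRecursion k δ p) (i : Fin (k + 1) → ℕ) : M.SqLinear (deviation k p i) := by
  induction h : i 0 using Nat.strong_induction_on generalizing i with
  | _ D ih =>
    by_cases hi : ValidIdx k i
    · refine SqLinear.deviation_of_drift hδ hp hi (SqLinear.add (SqLinear.sum fun j _ =>
        (ih (decUpTo k j i 0) ?_ _ rfl).const_mul _) (SqLinear.const _))
      have := hi.one_le 0
      simp only [decUpTo, Fin.val_zero, zero_le, if_true]
      omega
    · refine ⟨0, le_rfl, fun n => ?_⟩
      have : ∀ ω, deviation k p i n (M.G n ω) = 0 := fun ω => by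
        rw [deviation, (M.reachable n ω).Ncount_eq_zero n.succ_ne_zero hi, hp.1 i hi]
        simp
      simp [this]

/-- Along the squares the deviations are almost surely negligible. -/
lemma SqLinear.ae_tendsto {Y : ℕ → Finset (Finset ℕ) → ℝ} (h : M.SqLinear Y) :
    ∀ᵐ ω ∂M.μ, Tendsto (fun m : ℕ => Y ((m + 1) ^ 2) (M.G ((m + 1) ^ 2) ω) / ((m : ℝ) + 1) ^ 2)
      atTop (nhds 0) := by
  obtain ⟨K, hK, h⟩ := h
  let Z : ℕ → Ω → ℝ := fun m ω =>
    (Y ((m + 1) ^ 2) (M.G ((m + 1) ^ 2) ω) / ((m : ℝ) + 1) ^ 2) ^ 2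
  have hZ : ∀ m, Integrable (Z m) M.μ := fun m =>
    M.integrable_comp_G ((m + 1) ^ 2) fun g => (Y ((m + 1) ^ 2) g / ((m : ℝ) + 1) ^ 2) ^ 2
  have hbound : ∀ m, ∫ ω, Z m ω ∂M.μ ≤ 2 * K * (1 / ((m : ℝ) + 1) ^ 2) := by
    intro m
    have hm : (1 : ℝ) ≤ ((m : ℝ) + 1) ^ 2 := by
      have : (0 : ℝ) ≤ m := Nat.cast_nonneg m
      nlinarith
    have h1 := h ((m + 1) ^ 2)
    simp only [Z, div_pow]
    rw [integral_div, div_le_iff₀ (by positivity)]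
    refine h1.trans ?_
    have h2 : 2 * K * (1 / ((m : ℝ) + 1) ^ 2) * (((m : ℝ) + 1) ^ 2) ^ 2
      = 2 * K * ((m : ℝ) + 1) ^ 2 := by
      field_simp
    rw [h2]
    push_cast
    nlinarith
  have hsum : Summable fun m : ℕ => 2 * K * (1 / ((m : ℝ) + 1) ^ 2) := by
    refine Summable.mul_left _ ?_
    have := (summable_nat_add_iff 1).2 (Real.summable_one_div_nat_pow.2 one_lt_two)
    exact_mod_cast this
  have hfin : ∫⁻ ω, ∑' m, ENNReal.ofReal (Z m ω) ∂M.μ ≠ ⊤ := by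
    rw [lintegral_tsum fun m => (hZ m).1.aemeasurable.ennreal_ofReal]
    refine ne_top_of_le_ne_top hsum.tsum_ofReal_ne_top (ENNReal.tsum_le_tsum fun m => ?_)
    rw [← ofReal_integral_eq_lintegral_ofReal (hZ m) (ae_of_all _ fun ω => sq_nonneg _)]
    exact ENNReal.ofReal_le_ofReal (hbound m)
  have hmeas : AEMeasurable (fun ω => ∑' m, ENNReal.ofReal (Z m ω)) M.μ :=
    AEMeasurable.tsum fun m => (hZ m).1.aemeasurable.ennreal_ofReal
  filter_upwards [ae_lt_top' hmeas hfin] with ω hω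
  have h1 := ENNReal.tendsto_atTop_zero_of_tsum_ne_top hω.ne
  have h2 : Tendsto (fun m => Z m ω) atTop (nhds 0) := by
    have := (ENNReal.tendsto_toReal ENNReal.zero_ne_top).comp h1
    simpa [Function.comp_def, ENNReal.toReal_ofReal (sq_nonneg _), Z] using this
  have h3 := (Real.continuous_sqrt.tendsto 0).comp h2
  rw [Real.sqrt_zero] at h3
  refine tendsto_zero_iff_abs_tendsto_zero _ |>.2 (h3.congr fun m => ?_)
  simp only [Function.comp, Z, Real.sqrt_sq_eq_abs]

lemma ae_tendsto_Ncount (M : PAComplex k δ Ω) (hδ : -1 < δ) {p : (Fin (k + 1) → ℕ) → ℝ}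
    (hp : LimitRecursion k δ p) (i : Fin (k + 1) → ℕ) :
    ∀ᵐ ω ∂M.μ, Tendsto
      (fun n : ℕ => (Ncount k (M.G n ω) i : ℝ) / ((1 + (n + 1) * (k + 1) : ℕ) : ℝ))
      atTop (nhds (p i)) := by
  filter_upwards [(M.sqLinear_deviation hδ hp i).ae_tendsto] with ω hω
  have hC : ∀ n, |deviation k p i (n + 1) (M.G (n + 1) ω) - deviation k p i n (M.G n ω)|
      ≤ (k + 1) * (k + 2) + (k + 1) * |p i| := by
    intro n
    rw [M.G_succ]
    exact (M.reachable n ω).abs_deviation_sub_le (M.choice_succ_mem n ω) p i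
  have h1 := tendsto_div_of_tendsto_sq (u := fun n => deviation k p i n (M.G n ω)) hC hω
  have h2 : Tendsto (fun n : ℕ => (n : ℝ) / ((1 + (n + 1) * (k + 1) : ℕ) : ℝ)) atTop
      (nhds (1 / ((k : ℝ) + 1))) := by
    have h3 : Tendsto (fun n : ℕ => ((k : ℝ) + 2) / n + (k + 1)) atTop (nhds (0 + (k + 1))) :=
      (tendsto_const_div_atTop_nhds_zero_nat _).add_const _
    have h4 := h3.inv₀ (by positivity)
    rw [zero_add, ← one_div] at h4
    refine h4.congr' ?_
    filter_upwards [eventually_gt_atTop 0] with n hn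
    have : (n : ℝ) ≠ 0 := by positivity
    push_cast
    field_simp
    ring
  have h3 := (h1.mul h2).add_const (p i)
  rw [zero_mul, zero_add] at h3
  refine h3.congr' ?_
  filter_upwards [eventually_gt_atTop 0] with n hn
  have : (n : ℝ) ≠ 0 := by positivity
  have h5 : ((1 + (n + 1) * (k + 1) : ℕ) : ℝ) ≠ 0 := by positivity
  rw [deviation]
  push_cast at h5 ⊢
  field_simp
  ring

end PAComplex

/-- Strong law of large numbers for the joint degree counts: for every valid index vector
`1 ≤ i_k < ⋯ < i_0`, the empirical frequencies `N_n(i_0,…,i_k)/(1+(n+1)(k+1))` converge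
almost surely to `p_{i_0,…,i_k}`, the unique solution of the limiting degree recursion,
which is moreover a probability mass function. -/
theorem degree_counts_SLLN (k : ℕ) (δ : ℝ) (hδ : -1 < δ)
    (Ω : Type*) [MeasurableSpace Ω] (M : PAComplex k δ Ω) :
    (∃! p : (Fin (k + 1) → ℕ) → ℝ, LimitRecursion k δ p) ∧
    ∀ p : (Fin (k + 1) → ℕ) → ℝ, LimitRecursion k δ p →
      (∀ i, ValidIdx k i →
        ∀ᵐ ω ∂M.μ, Tendsto
          (fun n : ℕ => (Ncount k (M.G n ω) i : ℝ) / ((1 + (n + 1) * (k + 1) : ℕ) : ℝ))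
          atTop (nhds (p i))) ∧
      (∀ i, ValidIdx k i → 0 ≤ p i) ∧ HasSum p 1 := by
  refine ⟨existsUnique_limitRecursion k hδ, fun p hp => ⟨fun i _ => ?_, fun i _ => ?_, ?_⟩⟩
  · exact M.ae_tendsto_Ncount hδ hp i
  · exact hp.nonneg hδ i
  · exact hp.hasSum hδ
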